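/- arXiv:math/0404192 — 3 statements merged into one kernel-verified Lean document; each statement's English description precedes it below -/
import Mathlib

section
/- Let A be a set in ℝ^n and let D be an ellipsoid in ℝ^n containing the unit cube [0,1]^n. Then N(A, D) ≤ Σ(C·A)², where C is an absolute constant. -/
open MeasureTheory Filter
open scoped ENNReal NNReal Pointwise BigOperators

/-- The closed octant in `ℝ^n` with vertex `z` and signs `θ`. -/
def octant {n : ℕ} (θ z : Fin n → ℝ) : Set (Fin n → ℝ) :=
  {x | ∀ i, 0 ≤ (x i - z i) * θ i}

/-- The coordinate convex hull of `A`: what remains of `ℝ^n` after removing all closed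
octants disjoint from `A`; equivalently, the points `x` such that every octant containing `x`
intersects `A`. -/
def cconv {n : ℕ} (A : Set (Fin n → ℝ)) : Set (Fin n → ℝ) :=
  {x | ∀ θ z : Fin n → ℝ, (∀ i, θ i = 1 ∨ θ i = -1) → x ∈ octant θ z →
    (octant θ z ∩ A).Nonempty}

/-- The coordinate projection of `ℝ^n` onto `ℝ^σ`. -/
def coordProj {n : ℕ} (σ : Finset (Fin n)) (x : Fin n → ℝ) : Fin n → ℝ :=
  fun i => if i ∈ σ then x i else 0

/-- The integer cell `a + [0,1]^σ` in `ℝ^σ` (realized inside `ℝ^n` with zero coordinates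
off `σ`). -/
def intCell {n : ℕ} (σ : Finset (Fin n)) (a : Fin n → ℤ) : Set (Fin n → ℝ) :=
  {x | (∀ i ∈ σ, (a i : ℝ) ≤ x i ∧ x i ≤ (a i : ℝ) + 1) ∧ ∀ i ∉ σ, x i = 0}

/-- The cell content `Σ(A)`: the total number of integer cells contained in the coordinate
convex hulls of all coordinate projections of `A` (the summand for `σ = ∅` equals `1`
exactly when `A` is nonempty). -/
noncomputable def cellContent {n : ℕ} (A : Set (Fin n → ℝ)) : ℝ≥0∞ :=
  ∑ σ : Finset (Fin n),
    (({a : Fin n → ℤ | (∀ i ∉ σ, a i = 0) ∧ intCell σ a ⊆ cconv (coordProj σ '' A)}.encard :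
      ℕ∞) : ℝ≥0∞)

/-- The covering number `N(K,D)`: the minimal number of translates of `D` needed to cover
`K`. -/
noncomputable def coveringNumber {n : ℕ} (K D : Set (Fin n → ℝ)) : ℕ∞ :=
  ⨅ (m : ℕ) (_ : ∃ x : Fin m → Fin n → ℝ, K ⊆ ⋃ j, (fun y => x j + y) '' D), (m : ℕ∞)

/-- `D ⊆ ℝ^n` is an ellipsoid: the image of the closed unit Euclidean ball under an
invertible affine map. -/
def IsEllipsoid {n : ℕ} (D : Set (Fin n → ℝ)) : Prop :=
  ∃ (L : (Fin n → ℝ) ≃ₗ[ℝ] (Fin n → ℝ)) (z : Fin n → ℝ),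
    D = (fun x => z + L x) '' {x : Fin n → ℝ | ∑ i, (x i) ^ 2 ≤ 1}

/-! Rademacher moments -/
def rad {ι : Type} [DecidableEq ι] (s : Finset ι) (w : ι) : ℝ := if w ∈ s then 1 else -1

lemma rad_insert_sum {ι : Type} [DecidableEq ι] (t : Finset ι) (a : ι) (ha : a ∉ t) (c : ι → ℝ)
    (F : ℝ → ℝ) :
    ∑ s ∈ (insert a t).powerset, F (∑ w ∈ insert a t, rad s w * c w) =
    ∑ s ∈ t.powerset, (F (-c a + ∑ w ∈ t, rad s w * c w) + F (c a + ∑ w ∈ t, rad s w * c w)) := by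
  rw [Finset.sum_powerset_insert ha, ← Finset.sum_add_distrib]
  refine Finset.sum_congr rfl fun s hs => ?_
  have has : a ∉ s := fun h => ha (Finset.mem_powerset.1 hs h)
  rw [Finset.sum_insert ha, Finset.sum_insert ha]
  have e : ∑ w ∈ t, rad (insert a s) w * c w = ∑ w ∈ t, rad s w * c w := by
    refine Finset.sum_congr rfl fun w hw => ?_
    have : w ≠ a := fun h => ha (h ▸ hw)
    simp [rad, this]
  rw [e]
  simp [rad, has]

lemma rad_sq {ι : Type} [DecidableEq ι] (t : Finset ι) (c : ι → ℝ) :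
    ∑ s ∈ t.powerset, (∑ w ∈ t, rad s w * c w) ^ 2 = 2 ^ t.card * ∑ w ∈ t, c w ^ 2 := by
  induction t using Finset.induction_on with
  | empty => simp
  | insert a t ha ih =>
    rw [rad_insert_sum t a ha c (fun x => x ^ 2), Finset.card_insert_of_notMem ha,
      Finset.sum_insert ha]
    have : ∀ s ∈ t.powerset, ((-c a + ∑ w ∈ t, rad s w * c w) ^ 2 +
        (c a + ∑ w ∈ t, rad s w * c w) ^ 2) = 2 * c a ^ 2 + 2 * (∑ w ∈ t, rad s w * c w) ^ 2 := by
      intro s _; ring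
    rw [Finset.sum_congr rfl this, Finset.sum_add_distrib, ← Finset.mul_sum, ← Finset.mul_sum, ih]
    simp only [Finset.sum_const, Finset.card_powerset, nsmul_eq_mul]
    push_cast
    ring

lemma rad_four {ι : Type} [DecidableEq ι] (t : Finset ι) (c : ι → ℝ) :
    ∑ s ∈ t.powerset, (∑ w ∈ t, rad s w * c w) ^ 4 ≤ 2 ^ t.card * (3 * (∑ w ∈ t, c w ^ 2) ^ 2) := by
  induction t using Finset.induction_on with
  | empty => simp
  | insert a t ha ih =>
    rw [rad_insert_sum t a ha c (fun x => x ^ 4), Finset.card_insert_of_notMem ha,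
      Finset.sum_insert ha]
    have : ∀ s ∈ t.powerset, ((-c a + ∑ w ∈ t, rad s w * c w) ^ 4 +
        (c a + ∑ w ∈ t, rad s w * c w) ^ 4) = 2 * c a ^ 4 +
          12 * c a ^ 2 * (∑ w ∈ t, rad s w * c w) ^ 2 + 2 * (∑ w ∈ t, rad s w * c w) ^ 4 := by
      intro s _; ring
    rw [Finset.sum_congr rfl this, Finset.sum_add_distrib, Finset.sum_add_distrib,
      ← Finset.mul_sum, ← Finset.mul_sum, ← Finset.mul_sum, rad_sq]
    simp only [Finset.sum_const, Finset.card_powerset, nsmul_eq_mul]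
    push_cast
    have h4 : 0 ≤ c a ^ 4 := by positivity
    have h2 : (0:ℝ) ≤ 2 ^ t.card * c a ^ 4 := by positivity
    rw [pow_succ (2:ℝ)]
    nlinarith

/-- quadratic form -/
def qf {n : ℕ} (T : (Fin n → ℝ) →ₗ[ℝ] (Fin n → ℝ)) (x : Fin n → ℝ) : ℝ := ∑ k, (T x k) ^ 2

lemma qf_nonneg {n : ℕ} (T : (Fin n → ℝ) →ₗ[ℝ] (Fin n → ℝ)) (x) : 0 ≤ qf T x :=
  Finset.sum_nonneg fun _ _ => sq_nonneg _

lemma qf_add {n : ℕ} (T : (Fin n → ℝ) →ₗ[ℝ] (Fin n → ℝ)) (x y) :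
    qf T (x + y) ≤ 2 * qf T x + 2 * qf T y := by
  unfold qf
  rw [Finset.mul_sum, Finset.mul_sum, ← Finset.sum_add_distrib]
  refine Finset.sum_le_sum fun k _ => ?_
  rw [map_add, Pi.add_apply]
  nlinarith [sq_nonneg (T x k - T y k)]

lemma qf_smul {n : ℕ} (T : (Fin n → ℝ) →ₗ[ℝ] (Fin n → ℝ)) (r : ℝ) (x) :
    qf T (r • x) = r ^ 2 * qf T x := by
  unfold qf
  rw [Finset.mul_sum]
  refine Finset.sum_congr rfl fun k _ => ?_
  rw [map_smul, Pi.smul_apply, smul_eq_mul]; ring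

lemma qf_cube {n : ℕ} {T : (Fin n → ℝ) →ₗ[ℝ] (Fin n → ℝ)}
    (hT : ∀ w : Fin n → ℝ, (∀ i, |w i| ≤ 1/2) → qf T w ≤ 1)
    (M : ℝ) (hM : 0 ≤ M) (w : Fin n → ℝ) (hw : ∀ i, |w i| ≤ M) : qf T w ≤ 4 * M ^ 2 := by
  rcases hM.eq_or_lt with h | h
  · have : w = 0 := by
      ext i; have := hw i; rw [← h] at this; simpa using this
    subst this
    rw [← h]; simp [qf]
  · have h1 := hT ((1 / (2 * M)) • w) (by
      intro i
      rw [Pi.smul_apply, smul_eq_mul, abs_mul, abs_of_pos (by positivity)]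
      rw [div_mul_eq_mul_div, div_le_div_iff₀ (by positivity) (by positivity)]
      nlinarith [hw i])
    rw [qf_smul, div_pow, div_mul_eq_mul_div, div_le_one (by positivity)] at h1
    nlinarith

def PB {n : ℕ} (T : (Fin n → ℝ) →ₗ[ℝ] (Fin n → ℝ)) (B : ℝ) : Prop :=
  ∀ (ι : Type) (t : Finset ι) (X : ι → Fin n → ℝ) (v : ℝ), 0 < v →
    (∀ i, ∑ w ∈ t, X w i ^ 2 ≤ v) → ∑ w ∈ t, qf T (X w) ≤ B * v

lemma PB_init {n : ℕ} {T : (Fin n → ℝ) →ₗ[ℝ] (Fin n → ℝ)}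
    (hT : ∀ w : Fin n → ℝ, (∀ i, |w i| ≤ 1/2) → qf T w ≤ 1) : PB T (4 * n) := by
  intro ι t X v hv h
  calc ∑ w ∈ t, qf T (X w) ≤ ∑ w ∈ t, 4 * ∑ i, X w i ^ 2 := by
        refine Finset.sum_le_sum fun w _ => ?_
        have h0 : 0 ≤ ∑ i, X w i ^ 2 := Finset.sum_nonneg fun _ _ => sq_nonneg _
        have := qf_cube hT (√(∑ i, X w i ^ 2)) (Real.sqrt_nonneg _) (X w) (by
          intro i
          apply Real.abs_le_sqrt
          exact Finset.single_le_sum (f := fun i => X w i ^ 2) (fun _ _ => sq_nonneg _)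
            (Finset.mem_univ i))
        rwa [Real.sq_sqrt h0] at this
    _ = 4 * ∑ i, ∑ w ∈ t, X w i ^ 2 := by rw [← Finset.mul_sum, Finset.sum_comm]
    _ ≤ 4 * ∑ i : Fin n, v := by gcongr with i; exact h i
    _ = 4 * n * v := by simp; ring

lemma trunc_bd (M y : ℝ) (hM : 0 < M) : |max (-M) (min M y)| ≤ M ∧
    (y - max (-M) (min M y)) ^ 2 ≤ y ^ 4 / M ^ 2 := by
  constructor
  · rw [abs_le]; exact ⟨le_max_left _ _, max_le (by linarith) (min_le_left _ _)⟩
  · rw [le_div_iff₀ (by positivity)]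
    rcases le_total y M with h1 | h1
    · rw [min_eq_right h1]
      rcases le_total y (-M) with h2 | h2
      · rw [max_eq_left h2]
        have a1 : (y - -M)^2 ≤ y^2 := by nlinarith
        have a2 : M^2 ≤ y^2 := by nlinarith
        calc _ ≤ y^2 * y^2 := by gcongr
          _ = _ := by ring
      · rw [max_eq_right h2]; simp; positivity
    · rw [min_eq_left h1, max_eq_right (by linarith)]
      have a1 : (y - M)^2 ≤ y^2 := by nlinarith
      have a2 : M^2 ≤ y^2 := by nlinarith
      calc _ ≤ y^2 * y^2 := by gcongr
        _ = _ := by ring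

lemma PB_step {n : ℕ} {T : (Fin n → ℝ) →ₗ[ℝ] (Fin n → ℝ)}
    (hT : ∀ w : Fin n → ℝ, (∀ i, |w i| ≤ 1/2) → qf T w ≤ 1) (B : ℝ) (hB : PB T B) :
    PB T (96 + B / 2) := by
  classical
  intro ι t X v hv h
  set M : ℝ := √(12 * v) with hMdef
  have hM : 0 < M := Real.sqrt_pos.2 (by linarith)
  have hM2 : M ^ 2 = 12 * v := Real.sq_sqrt (by linarith)
  let Y : Finset ι → Fin n → ℝ := fun s => ∑ w ∈ t, rad s w • X w
  let Tr : Finset ι → Fin n → ℝ := fun s i => max (-M) (min M (Y s i))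
  let R : Finset ι → Fin n → ℝ := fun s => Y s - Tr s
  have hY : ∀ s i, Y s i = ∑ w ∈ t, rad s w * X w i := by
    intro s i; simp [Y, Finset.sum_apply]
  have e1 : ∑ s ∈ t.powerset, qf T (Y s) = 2 ^ t.card * ∑ w ∈ t, qf T (X w) := by
    unfold qf
    rw [Finset.sum_comm, Finset.sum_comm (s := t), Finset.mul_sum]
    refine Finset.sum_congr rfl fun k _ => ?_
    rw [← rad_sq t (fun w => T (X w) k)]
    refine Finset.sum_congr rfl fun s _ => ?_
    simp [Y, map_sum, Finset.sum_apply]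
  have e2 : ∀ s, qf T (Y s) ≤ 96 * v + 2 * qf T (R s) := by
    intro s
    have h1 := qf_add T (Tr s) (R s)
    have h2 : Tr s + R s = Y s := by simp [R]
    rw [h2] at h1
    have h3 := qf_cube hT M hM.le (Tr s) (fun i => (trunc_bd M _ hM).1)
    rw [hM2] at h3
    linarith
  have p2 : (0:ℝ) < 2 ^ t.card := by positivity
  have e3 : ∑ s ∈ t.powerset, qf T (R s) ≤ B * (2 ^ t.card * v / 4) := by
    refine hB _ _ R _ (by positivity) fun i => ?_
    calc ∑ s ∈ t.powerset, R s i ^ 2 ≤ ∑ s ∈ t.powerset, (Y s i) ^ 4 / M ^ 2 :=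
          Finset.sum_le_sum fun s _ => (trunc_bd M _ hM).2
      _ = (∑ s ∈ t.powerset, (∑ w ∈ t, rad s w * X w i) ^ 4) / M ^ 2 := by
          rw [Finset.sum_div]; simp only [hY]
      _ ≤ (2 ^ t.card * (3 * v ^ 2)) / M ^ 2 := by
          gcongr
          refine (rad_four t _).trans ?_
          have h0 : 0 ≤ ∑ w ∈ t, X w i ^ 2 := Finset.sum_nonneg fun _ _ => sq_nonneg _
          gcongr
          exact h i
      _ = _ := by rw [hM2]; field_simp; norm_num
  have e4 : ∑ s ∈ t.powerset, qf T (Y s) ≤ 2 ^ t.card * (96 * v) +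
      2 * ∑ s ∈ t.powerset, qf T (R s) := by
    refine (Finset.sum_le_sum fun s _ => e2 s).trans ?_
    rw [Finset.sum_add_distrib, ← Finset.mul_sum]
    simp only [Finset.sum_const, Finset.card_powerset, nsmul_eq_mul]
    push_cast
    rw [← Finset.mul_sum]
    linarith
  rw [e1] at e4
  have : 2 ^ t.card * ∑ w ∈ t, qf T (X w) ≤ 2 ^ t.card * ((96 + B / 2) * v) := by
    linarith
  exact le_of_mul_le_mul_left this p2

lemma PB_main {n : ℕ} {T : (Fin n → ℝ) →ₗ[ℝ] (Fin n → ℝ)}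
    (hT : ∀ w : Fin n → ℝ, (∀ i, |w i| ≤ 1/2) → qf T w ≤ 1) : PB T 192 := by
  have key : ∀ k : ℕ, PB T (192 + 4 * n * (1 / 2) ^ k) := by
    intro k
    induction k with
    | zero =>
      intro ι t X v hv h
      have := PB_init hT ι t X v hv h
      simp only [pow_zero, mul_one]
      linarith
    | succ k ih =>
      have := PB_step hT _ ih
      convert this using 1
      ring
  intro ι t X v hv h
  have h1 : Tendsto (fun k : ℕ => (192 + 4 * (n:ℝ) * (1 / 2) ^ k) * v) atTop
      (nhds ((192 + 4 * n * 0) * v)) := by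
    refine Tendsto.mul_const _ (Tendsto.const_add _ (Tendsto.const_mul _ ?_))
    exact tendsto_pow_atTop_nhds_zero_of_lt_one (by norm_num) (by norm_num)
  have := ge_of_tendsto' h1 (fun k => key k ι t X v hv h)
  simpa using this

/-! small deviations -/
lemma tail_bd {α : Type} (S : Finset α) (f : α → ℝ)
    (H : ∀ k : ℤ, (S.filter (fun x => f x ≤ k)).Nonempty → (S.filter (fun x => (k:ℝ) + 1 ≤ f x)).Nonempty →
      √((S.filter (fun x => f x ≤ k)).card : ℝ) + √((S.filter (fun x => (k:ℝ) + 1 ≤ f x)).card : ℝ) < √(S.card : ℝ))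
    (m : ℤ) (hm : ((S.filter (fun x => (m:ℝ) ≤ f x)).card : ℝ) ≤ S.card / 2) (j : ℕ) :
    ((S.filter (fun x => (m:ℝ) + j ≤ f x)).card : ℝ) ≤ S.card / 2 ^ (j + 1) := by
  classical
  induction j with
  | zero => simpa using hm
  | succ j ih =>
    by_cases hb : (S.filter (fun x => (((m + j : ℤ):ℝ)) + 1 ≤ f x)).Nonempty
    swap
    · rw [Finset.not_nonempty_iff_eq_empty] at hb
      push_cast at hb ⊢
      rw [← add_assoc, hb]; simp; positivity
    have hN : 0 < (S.card : ℝ) := by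
      obtain ⟨x, hx⟩ := hb
      exact_mod_cast Finset.card_pos.2 ⟨x, (Finset.mem_filter.1 hx).1⟩
    have hsum : (S.card : ℝ) ≤ (S.filter (fun x => f x ≤ ((m + j : ℤ):ℝ))).card +
        (S.filter (fun x => (m:ℝ) + j ≤ f x)).card := by
      have : S.card ≤ (S.filter (fun x => f x ≤ ((m + j : ℤ):ℝ)) ∪ S.filter (fun x => (m:ℝ) + j ≤ f x)).card := by
        apply Finset.card_le_card
        intro x hx
        simp only [Finset.mem_union, Finset.mem_filter, hx, true_and]
        push_cast
        exact le_total _ _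
      exact_mod_cast this.trans (Finset.card_union_le _ _)
    have hhalf : (S.card : ℝ) / 2 ^ (j + 1) ≤ S.card / 2 := by
      apply div_le_div_of_nonneg_left hN.le (by norm_num)
      calc (2:ℝ) = 2 ^ 1 := by norm_num
        _ ≤ _ := pow_le_pow_right₀ (by norm_num) (by omega)
    have ha : (S.filter (fun x => f x ≤ ((m + j : ℤ):ℝ))).Nonempty := by
      rw [← Finset.card_pos]
      have : (0:ℝ) < (S.filter (fun x => f x ≤ ((m + j : ℤ):ℝ))).card := by linarith
      exact_mod_cast this
    have h := H (m + j) ha hb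
    have eb : ((m + (j + 1 : ℕ) : ℝ)) = ((m + j : ℤ):ℝ) + 1 := by push_cast; ring
    rw [eb]
    set a : ℝ := (((S.filter (fun x => f x ≤ ((m + j : ℤ):ℝ))).card : ℕ) : ℝ)
    set b : ℝ := (((S.filter (fun x => ((m + j : ℤ):ℝ) + 1 ≤ f x)).card : ℕ) : ℝ)
    set c : ℝ := (((S.filter (fun x => (m:ℝ) + j ≤ f x)).card : ℕ) : ℝ)
    set N : ℝ := ((S.card : ℕ) : ℝ)
    have hb0 : 0 ≤ b := Nat.cast_nonneg _
    have ha0 : 0 ≤ a := Nat.cast_nonneg _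
    have sa := Real.sq_sqrt ha0
    have sb := Real.sq_sqrt hb0
    have sN := Real.sq_sqrt hN.le
    have na := Real.sqrt_nonneg a
    have nb := Real.sqrt_nonneg b
    have nN := Real.sqrt_pos.2 hN
    -- b * N ≤ (N - a)^2 ≤ c^2
    have g1 : √b * √N ≤ c := by
      nlinarith
    have g2 : b * N ≤ c ^ 2 := by
      calc b * N = (√b * √N) ^ 2 := by rw [mul_pow, sb, sN]
        _ ≤ c ^ 2 := by gcongr
    have hc0 : 0 ≤ c := Nat.cast_nonneg _
    have g3 : c ^ 2 ≤ (N / 2 ^ (j+1)) * (N / 2) := by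
      rw [sq]; exact mul_le_mul ih (ih.trans hhalf) hc0 (by positivity)
    have g4 : b * N ≤ (N / 2 ^ (j + 1 + 1)) * N := by
      refine (g2.trans g3).trans (le_of_eq ?_)
      rw [pow_succ _ (j+1)]; field_simp
    exact le_of_mul_le_mul_right g4 hN

lemma layer (y : ℝ) (R : ℕ) (hR : |y| < R) :
    y ^ 2 ≤ ∑ j ∈ Finset.range R, (2 * (j:ℝ) + 1) * (if (j:ℝ) ≤ |y| then 1 else 0) := by
  have : ∀ R : ℕ, min (|y|) R ^ 2 ≤ ∑ j ∈ Finset.range R, (2 * (j:ℝ) + 1) * (if (j:ℝ) ≤ |y| then 1 else 0) := by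
    intro R
    induction R with
    | zero => simp
    | succ R ih =>
      rw [Finset.sum_range_succ]
      have hy := abs_nonneg y
      split_ifs with h
      · rw [min_eq_right h] at ih
        have h1 : min |y| ((R+1:ℕ):ℝ) ≤ R + 1 := by push_cast; exact min_le_right _ _
        have h2 : 0 ≤ min |y| ((R+1:ℕ):ℝ) := le_min hy (by positivity)
        nlinarith
      · push Not at h
        rw [min_eq_left h.le] at ih
        rw [min_eq_left (by push_cast; linarith)]
        simpa using ih
  have h := this R
  rwa [min_eq_left hR.le, sq_abs] at h

lemma geo (R : ℕ) : ∑ j ∈ Finset.range R, (2 * (j:ℝ) + 1) * (1 / 2 ^ j) = 6 - (4 * R + 6) / 2 ^ R := by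
  induction R with
  | zero => simp
  | succ R ih =>
    rw [Finset.sum_range_succ, ih]; push_cast; field_simp; ring

lemma small_dev {α : Type} (S : Finset α) (hS : S.Nonempty) (f : α → ℝ)
    (H : ∀ k : ℤ, (S.filter (fun x => f x ≤ k)).Nonempty → (S.filter (fun x => (k:ℝ) + 1 ≤ f x)).Nonempty →
      √((S.filter (fun x => f x ≤ k)).card : ℝ) + √((S.filter (fun x => (k:ℝ) + 1 ≤ f x)).card : ℝ) < √(S.card : ℝ)) :
    ∑ p ∈ S ×ˢ S, (f p.1 - f p.2) ^ 2 ≤ 48 * (S.card : ℝ) ^ 2 := by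
  classical
  have hN : 0 < (S.card : ℝ) := by exact_mod_cast Finset.card_pos.2 hS
  obtain ⟨m, hm1, hm2⟩ := Int.exists_greatest_of_bdd
    (P := fun m : ℤ => (S.card : ℝ) / 2 < (S.filter (fun x => (m:ℝ) ≤ f x)).card) (by
      obtain ⟨b, hb⟩ := (S.image f).bddAbove
      refine ⟨⌈b⌉, fun z hz => ?_⟩
      have : (0:ℝ) < (S.filter (fun x => (z:ℝ) ≤ f x)).card := lt_trans (by positivity) hz
      have : 0 < (S.filter (fun x => (z:ℝ) ≤ f x)).card := by exact_mod_cast this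
      obtain ⟨x, hx⟩ := Finset.card_pos.1 this
      rw [Finset.mem_filter] at hx
      have h1 : f x ≤ b := hb (by simpa using ⟨x, hx.1, rfl⟩)
      have : (z:ℝ) ≤ ⌈b⌉ := (hx.2.trans h1).trans (Int.le_ceil b)
      exact_mod_cast this) (by
      obtain ⟨b, hb⟩ := (S.image f).bddBelow
      refine ⟨⌊b⌋, ?_⟩
      rw [Finset.filter_true_of_mem]
      · linarith
      · intro x hx
        exact (Int.floor_le b).trans (hb (by simpa using ⟨x, hx, rfl⟩)))
  have up := tail_bd S f H (m + 1) (by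
    by_contra hc
    push Not at hc
    have := hm2 (m + 1) hc
    omega)
  have lo := tail_bd S (fun x => - f x) (by
    intro k h1 h2
    have e1 : (S.filter (fun x => -f x ≤ k)) = S.filter (fun x => ((-k-1 : ℤ):ℝ) + 1 ≤ f x) := by
      ext x; simp only [Finset.mem_filter]; push_cast
      constructor <;> rintro ⟨a, b⟩ <;> exact ⟨a, by linarith⟩
    have e2 : (S.filter (fun x => (k:ℝ) + 1 ≤ -f x)) = S.filter (fun x => f x ≤ ((-k-1 : ℤ):ℝ)) := by
      ext x; simp only [Finset.mem_filter]; push_cast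
      constructor <;> rintro ⟨a, b⟩ <;> exact ⟨a, by linarith⟩
    rw [e1] at h1 ⊢
    rw [e2] at h2 ⊢
    rw [add_comm]
    exact H _ h2 h1) (-m + 1) (by
    have hd : (S.filter (fun x => ((-m+1 : ℤ):ℝ) ≤ -f x)).card + (S.filter (fun x => (m:ℝ) ≤ f x)).card ≤ S.card := by
      rw [← Finset.card_union_of_disjoint]
      · apply Finset.card_le_card
        exact Finset.union_subset (Finset.filter_subset _ _) (Finset.filter_subset _ _)
      · rw [Finset.disjoint_filter]
        intro x _ h1 h2
        push_cast at h1
        linarith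
    have hd' : ((S.filter (fun x => ((-m+1 : ℤ):ℝ) ≤ -f x)).card : ℝ) + (S.filter (fun x => (m:ℝ) ≤ f x)).card ≤ S.card := by
      exact_mod_cast hd
    linarith)
  have tail : ∀ j : ℕ, ((S.filter (fun x => (j:ℝ) ≤ |f x - m|)).card : ℝ) ≤ 2 * S.card * (1 / 2 ^ j) := by
    intro j
    cases j with
    | zero =>
      have : ((S.filter (fun x => ((0:ℕ):ℝ) ≤ |f x - m|)).card : ℝ) ≤ S.card := by
        exact_mod_cast Finset.card_filter_le _ _
      simp only [pow_zero, div_one, mul_one]; linarith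
    | succ j =>
      have h1 := up j
      have h2 := lo j
      have : (S.filter (fun x => ((j+1:ℕ):ℝ) ≤ |f x - m|)).card ≤
          (S.filter (fun x => ((m+1:ℤ):ℝ) + j ≤ f x)).card + (S.filter (fun x => ((-m+1:ℤ):ℝ) + j ≤ -f x)).card := by
        refine le_trans (Finset.card_le_card ?_) (Finset.card_union_le _ _)
        intro x hx
        simp only [Finset.mem_union, Finset.mem_filter] at hx ⊢
        push_cast at hx ⊢
        rcases le_abs.1 hx.2 with h | h
        · left; exact ⟨hx.1, by linarith⟩
        · right; exact ⟨hx.1, by linarith⟩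
      have : ((S.filter (fun x => ((j+1:ℕ):ℝ) ≤ |f x - m|)).card : ℝ) ≤
          (S.filter (fun x => ((m+1:ℤ):ℝ) + j ≤ f x)).card + (S.filter (fun x => ((-m+1:ℤ):ℝ) + j ≤ -f x)).card := by
        exact_mod_cast this
      calc _ ≤ _ := this
        _ ≤ S.card / 2 ^ (j+1) + S.card / 2 ^ (j+1) := add_le_add h1 h2
        _ = _ := by ring
  have second : ∑ x ∈ S, (f x - m) ^ 2 ≤ 12 * S.card := by
    obtain ⟨b, hb⟩ := (S.image (fun x => |f x - m|)).bddAbove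
    obtain ⟨R, hR⟩ := exists_nat_gt b
    calc ∑ x ∈ S, (f x - m) ^ 2 ≤ ∑ x ∈ S, ∑ j ∈ Finset.range R, (2 * (j:ℝ) + 1) * (if (j:ℝ) ≤ |f x - m| then 1 else 0) := by
          refine Finset.sum_le_sum fun x hx => layer _ R (lt_of_le_of_lt (hb ?_) hR)
          simpa using ⟨x, hx, rfl⟩
      _ = ∑ j ∈ Finset.range R, (2 * (j:ℝ) + 1) * ((S.filter (fun x => (j:ℝ) ≤ |f x - m|)).card : ℝ) := by
          rw [Finset.sum_comm]
          refine Finset.sum_congr rfl fun j _ => ?_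
          rw [← Finset.mul_sum, Finset.sum_boole]
      _ ≤ ∑ j ∈ Finset.range R, (2 * (j:ℝ) + 1) * (2 * S.card * (1 / 2 ^ j)) := by
          gcongr with j; exact tail j
      _ = 2 * S.card * ∑ j ∈ Finset.range R, (2 * (j:ℝ) + 1) * (1 / 2 ^ j) := by
          rw [Finset.mul_sum]; refine Finset.sum_congr rfl fun j _ => by ring
      _ ≤ 2 * S.card * 6 := by
          rw [geo]; gcongr
          have : (0:ℝ) ≤ (4 * R + 6) / 2 ^ R := by positivity
          linarith
      _ = _ := by ring
  calc ∑ p ∈ S ×ˢ S, (f p.1 - f p.2) ^ 2 ≤ ∑ p ∈ S ×ˢ S, (2 * (f p.1 - m) ^ 2 + 2 * (f p.2 - m) ^ 2) := by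
        refine Finset.sum_le_sum fun p _ => ?_
        nlinarith [sq_nonneg (f p.1 - m + (f p.2 - m))]
    _ = 4 * S.card * ∑ x ∈ S, (f x - m) ^ 2 := by
        rw [Finset.sum_product]
        simp only [Finset.sum_add_distrib, Finset.sum_const, ← Finset.mul_sum, nsmul_eq_mul]
        ring
    _ ≤ 4 * S.card * (12 * S.card) := by gcongr
    _ = _ := by ring

def cellSet {n : ℕ} (A : Set (Fin n → ℝ)) : Set (Finset (Fin n) × (Fin n → ℤ)) :=
  {p | (∀ i ∉ p.1, p.2 i = 0) ∧ intCell p.1 p.2 ⊆ cconv (coordProj p.1 '' A)}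

lemma cellContent_eq {n : ℕ} (A : Set (Fin n → ℝ)) :
    cellContent A = ((cellSet A).encard : ℝ≥0∞) := by
  have h : cellSet A = ⋃ σ : Finset (Fin n), (fun a => (σ, a)) ''
      {a : Fin n → ℤ | (∀ i ∉ σ, a i = 0) ∧ intCell σ a ⊆ cconv (coordProj σ '' A)} := by
    ext ⟨σ, a⟩
    simp [cellSet]
  rw [h, Set.encard_iUnion_of_finite, finsum_eq_sum_of_fintype]
  · unfold cellContent
    rw [← ENat.toENNRealRingHom_apply, map_sum]
    refine Finset.sum_congr rfl fun σ _ => ?_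
    rw [Function.Injective.encard_image]
    intro a b hab; simpa using hab
  · intro σ τ hst
    rw [Function.onFun, Set.disjoint_left]
    rintro _ ⟨a, _, rfl⟩ ⟨b, _, hb⟩
    exact hst (by simpa using (congrArg Prod.fst hb).symm)

lemma cconv_mono {n : ℕ} {A B : Set (Fin n → ℝ)} (h : A ⊆ B) : cconv A ⊆ cconv B :=
  fun _ hx θ z hθ ho => (hx θ z hθ ho).mono (Set.inter_subset_inter_right _ h)

lemma cellSet_mono {n : ℕ} {A B : Set (Fin n → ℝ)} (h : A ⊆ B) : cellSet A ⊆ cellSet B :=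
  fun _ hp => ⟨hp.1, hp.2.trans (cconv_mono (Set.image_mono h))⟩

lemma cellContent_mono {n : ℕ} {A B : Set (Fin n → ℝ)} (h : A ⊆ B) :
    cellContent A ≤ cellContent B := by
  rw [cellContent_eq, cellContent_eq, ENat.toENNReal_le]
  exact Set.encard_le_encard (cellSet_mono h)

lemma one_le_cellContent {n : ℕ} {A : Set (Fin n → ℝ)} (h : A.Nonempty) : 1 ≤ cellContent A := by
  rw [cellContent_eq]
  have : (1 : ℕ∞) ≤ (cellSet A).encard := by
    rw [Set.one_le_encard_iff_nonempty]
    refine ⟨(∅, 0), by simp, ?_⟩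
    intro x hx θ z hθ ho
    obtain ⟨y, hy⟩ := h
    have hx0 : x = coordProj ∅ y := by
      ext i; simpa [coordProj] using hx.2 i (by simp)
    exact ⟨x, ho, y, hy, hx0.symm⟩
  exact_mod_cast this

lemma intCell_corner {n : ℕ} (σ : Finset (Fin n)) (a : Fin n → ℤ) (i : Fin n) (hi : i ∈ σ)
    (δ : ℝ) (h0 : 0 ≤ δ) (h1 : δ ≤ 1) :
    ∃ x ∈ intCell σ a, x i = a i + δ := by
  refine ⟨fun j => if j ∈ σ then a j + δ else 0, ⟨fun j hj => ?_, fun j hj => ?_⟩, ?_⟩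
  · simp [hj, h0, h1]
  · simp [hj]
  · simp [hi]

lemma cconv_ge {n : ℕ} {A : Set (Fin n → ℝ)} {i : Fin n} {c : ℝ} (h : ∀ x ∈ A, c ≤ x i)
    {x : Fin n → ℝ} (hx : x ∈ cconv A) : c ≤ x i := by
  obtain ⟨y, hy, hyA⟩ := hx (fun _ => -1) x (by simp) (by intro j; simp)
  have := hy i
  have := h y hyA
  linarith

lemma cconv_le {n : ℕ} {A : Set (Fin n → ℝ)} {i : Fin n} {c : ℝ} (h : ∀ x ∈ A, x i ≤ c)
    {x : Fin n → ℝ} (hx : x ∈ cconv A) : x i ≤ c := by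
  obtain ⟨y, hy, hyA⟩ := hx (fun _ => 1) x (by simp) (by intro j; simp)
  have := hy i
  have := h y hyA
  linarith

lemma cellSet_ge {n : ℕ} {A : Set (Fin n → ℝ)} {i : Fin n} {k : ℤ} (h : ∀ x ∈ A, (k:ℝ) ≤ x i)
    {p : Finset (Fin n) × (Fin n → ℤ)} (hp : p ∈ cellSet A) (hi : i ∈ p.1) : k ≤ p.2 i := by
  obtain ⟨x, hx, hxi⟩ := intCell_corner p.1 p.2 i hi 0 le_rfl zero_le_one
  have := cconv_ge (i := i) (c := k) (by
    rintro _ ⟨y, hy, rfl⟩; simpa [coordProj, hi] using h y hy) (hp.2 hx)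
  rw [hxi, add_zero] at this
  exact_mod_cast this

lemma cellSet_le {n : ℕ} {A : Set (Fin n → ℝ)} {i : Fin n} {k : ℤ} (h : ∀ x ∈ A, x i ≤ (k:ℝ))
    {p : Finset (Fin n) × (Fin n → ℤ)} (hp : p ∈ cellSet A) (hi : i ∈ p.1) : p.2 i + 1 ≤ k := by
  obtain ⟨x, hx, hxi⟩ := intCell_corner p.1 p.2 i hi 1 zero_le_one le_rfl
  have := cconv_le (i := i) (c := k) (by
    rintro _ ⟨y, hy, rfl⟩; simpa [coordProj, hi] using h y hy) (hp.2 hx)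
  rw [hxi] at this
  exact_mod_cast this

lemma cell_split {n : ℕ} {A A1 A2 : Set (Fin n → ℝ)} (h1 : A1 ⊆ A) (h2 : A2 ⊆ A) (i : Fin n)
    (k : ℤ) (hA1 : ∀ x ∈ A1, x i ≤ (k:ℝ)) (hA2 : ∀ x ∈ A2, (k:ℝ) + 1 ≤ x i) :
    cellContent A1 + cellContent A2 ≤ cellContent A := by
  have hA2' : ∀ x ∈ A2, ((k + 1 : ℤ):ℝ) ≤ x i := by push_cast; exact hA2
  have key : (cellSet A1).encard + (cellSet A2).encard ≤ (cellSet A).encard := by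
    rw [← Set.encard_union_add_encard_inter]
    let g : Finset (Fin n) × (Fin n → ℤ) → Finset (Fin n) × (Fin n → ℤ) :=
      fun p => (insert i p.1, Function.update p.2 i k)
    have hni : ∀ p ∈ cellSet A1 ∩ cellSet A2, i ∉ p.1 := by
      intro p hp hi
      have a1 := cellSet_le hA1 hp.1 hi
      have a2 := cellSet_ge hA2' hp.2 hi
      omega
    have ginj : Set.InjOn g (cellSet A1 ∩ cellSet A2) := by
      intro p hp q hq hpq
      have hp' := hni p hp
      have hq' := hni q hq
      simp only [g, Prod.mk.injEq] at hpq
      refine Prod.ext ?_ ?_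
      · rw [← Finset.erase_insert hp', ← Finset.erase_insert hq', hpq.1]
      · ext j
        by_cases hj : j = i
        · subst hj; rw [hp.1.1 j hp', hq.1.1 j hq']
        · have := congrFun hpq.2 j
          simpa [Function.update_of_ne hj] using this
    rw [← ginj.encard_image, ← Set.encard_union_eq]
    · apply Set.encard_le_encard
      refine Set.union_subset (Set.union_subset (cellSet_mono h1) (cellSet_mono h2)) ?_
      rintro _ ⟨p, hp, rfl⟩
      have hp' := hni p hp
      refine ⟨?_, ?_⟩
      · intro j hj
        simp only [g, Finset.mem_insert, not_or] at hj ⊢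
        rw [Function.update_of_ne hj.1]
        exact hp.1.1 j hj.2
      · intro x hx θ z hθ ho
        simp only [g] at hx ⊢
        have hxi := hx.1 i (Finset.mem_insert_self _ _)
        rw [Function.update_self] at hxi
        -- the projected point
        have hx' : Function.update x i 0 ∈ intCell p.1 p.2 := by
          refine ⟨fun j hj => ?_, fun j hj => ?_⟩
          · have hji : j ≠ i := fun h => hp' (h ▸ hj)
            have := hx.1 j (Finset.mem_insert_of_mem hj)
            simpa [Function.update_of_ne hji] using this
          · by_cases hji : j = i
            · subst hji; simp
            · rw [Function.update_of_ne hji]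
              exact hx.2 j (by simp [hji, hj])
        have hx'' : Function.update x i 0 ∈ octant θ (Function.update z i 0) := by
          intro j
          by_cases hji : j = i
          · subst hji; simp
          · simpa [Function.update_of_ne hji] using ho j
        have fin : ∀ y ∈ A, coordProj p.1 y ∈ octant θ (Function.update z i 0) →
            0 ≤ (y i - z i) * θ i →
            (octant θ z ∩ coordProj (insert i p.1) '' A).Nonempty := by
          intro y hy hyo hyi
          refine ⟨_, ?_, y, hy, rfl⟩
          intro j
          by_cases hji : j = i
          · subst hji; simpa [coordProj] using hyi
          · simpa [Function.update_of_ne hji, coordProj, hji] using hyo j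
        have hoi := ho i
        rcases hθ i with ht | ht
        · obtain ⟨_, hyo, y, hy, rfl⟩ := hp.2.2 hx' θ _ hθ hx''
          refine fin y (h2 hy) hyo ?_
          rw [ht] at hoi ⊢
          have := hA2 y hy
          linarith [hxi.2]
        · obtain ⟨_, hyo, y, hy, rfl⟩ := hp.1.2 hx' θ _ hθ hx''
          refine fin y (h1 hy) hyo ?_
          rw [ht] at hoi ⊢
          have := hA1 y hy
          linarith [hxi.1]
    · rw [Set.disjoint_right]
      rintro _ ⟨p, hp, rfl⟩ (h | h)
      · have := cellSet_le hA1 h (Finset.mem_insert_self _ _)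
        simp [g] at this
      · have := cellSet_ge hA2' h (Finset.mem_insert_self _ _)
        simp [g] at this
  rw [cellContent_eq, cellContent_eq, cellContent_eq]
  exact_mod_cast key

def sep {n : ℕ} (T : (Fin n → ℝ) →ₗ[ℝ] (Fin n → ℝ)) (S : Finset (Fin n → ℝ)) : Prop :=
  ∀ x ∈ S, ∀ y ∈ S, x ≠ y → 1 < qf T (x - y)

lemma sep_coord {n : ℕ} {T : (Fin n → ℝ) →ₗ[ℝ] (Fin n → ℝ)}
    (hT : ∀ w : Fin n → ℝ, (∀ i, |w i| ≤ 1/2) → qf T w ≤ 1) (S : Finset (Fin n → ℝ))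
    (hS : sep T S) (h2 : 2 ≤ S.card) :
    ∃ i, (S.card : ℝ) ^ 2 / 400 < ∑ p ∈ S ×ˢ S, (p.1 i - p.2 i) ^ 2 := by
  classical
  by_contra hc
  push Not at hc
  have hN : (2:ℝ) ≤ S.card := by exact_mod_cast h2
  have h := PB_main hT _ (S ×ˢ S) (fun p => p.1 - p.2) ((S.card : ℝ) ^ 2 / 400) (by positivity)
    (fun i => by simpa using hc i)
  have lower : (S.card : ℝ) ^ 2 - S.card ≤ ∑ p ∈ S ×ˢ S, qf T (p.1 - p.2) := by
    rw [Finset.sum_product]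
    have : ∀ x ∈ S, (S.card : ℝ) - 1 ≤ ∑ y ∈ S, qf T (x - y) := by
      intro x hx
      rw [← Finset.add_sum_erase S _ hx]
      have h1 : ∑ y ∈ S.erase x, (1:ℝ) ≤ ∑ y ∈ S.erase x, qf T (x - y) :=
        Finset.sum_le_sum fun y hy => (hS x hx y (Finset.mem_of_mem_erase hy)
          (Finset.ne_of_mem_erase hy).symm).le
      simp only [Finset.sum_const, nsmul_eq_mul, mul_one] at h1
      have h3 : ((S.erase x).card : ℝ) + 1 = S.card := by
        exact_mod_cast Finset.card_erase_add_one hx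
      have := qf_nonneg T (x - x)
      linarith
    have := Finset.sum_le_sum this
    simp only [Finset.sum_const, nsmul_eq_mul] at this
    linarith
  nlinarith

lemma main_ind {n : ℕ} {T : (Fin n → ℝ) →ₗ[ℝ] (Fin n → ℝ)}
    (hT : ∀ w : Fin n → ℝ, (∀ i, |w i| ≤ 1/2) → qf T w ≤ 1) (S : Finset (Fin n → ℝ)) :
    S.Nonempty → sep T S →
    ENNReal.ofReal (√(S.card : ℝ)) ≤ cellContent ((200:ℝ) • (S : Set (Fin n → ℝ))) := by
  classical
  induction S using Finset.strongInduction with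
  | H S ih =>
  intro hne hS
  by_cases h2 : 2 ≤ S.card
  swap
  · have : S.card = 1 := by have := hne.card_pos; omega
    rw [this]
    simpa using one_le_cellContent (A := (200:ℝ) • (S : Set (Fin n → ℝ))) (by simpa using hne)
  obtain ⟨i, hi⟩ := sep_coord hT S hS h2
  have hN : (2:ℝ) ≤ S.card := by exact_mod_cast h2
  have hbig : ¬ (∑ p ∈ S ×ˢ S, (200 * p.1 i - 200 * p.2 i) ^ 2 ≤ 48 * (S.card : ℝ) ^ 2) := by
    push Not
    have e : ∑ p ∈ S ×ˢ S, (200 * p.1 i - 200 * p.2 i) ^ 2 =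
        40000 * ∑ p ∈ S ×ˢ S, (p.1 i - p.2 i) ^ 2 := by
      rw [Finset.mul_sum]; exact Finset.sum_congr rfl fun p _ => by ring
    rw [e]
    nlinarith
  have := mt (small_dev S hne (fun x => 200 * x i)) hbig
  push Not at this
  obtain ⟨k, n1, n2, hk⟩ := this
  set S1 := S.filter (fun x => 200 * x i ≤ (k:ℝ)) with hS1
  set S2 := S.filter (fun x => (k:ℝ) + 1 ≤ 200 * x i) with hS2
  have s1 : S1 ⊆ S := Finset.filter_subset _ _
  have s2 : S2 ⊆ S := Finset.filter_subset _ _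
  have m1 : ∀ x ∈ S1, 200 * x i ≤ k := fun x hx => (Finset.mem_filter.1 hx).2
  have m2 : ∀ x ∈ S2, (k:ℝ) + 1 ≤ 200 * x i := fun x hx => (Finset.mem_filter.1 hx).2
  have ss1 : S1 ⊂ S := by
    refine Finset.ssubset_iff_subset_ne.2 ⟨s1, fun h => ?_⟩
    obtain ⟨x, hx⟩ := n2
    have a := m2 x hx
    have b := m1 x (h ▸ s2 hx)
    linarith
  have ss2 : S2 ⊂ S := by
    refine Finset.ssubset_iff_subset_ne.2 ⟨s2, fun h => ?_⟩
    obtain ⟨x, hx⟩ := n1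
    have a := m1 x hx
    have b := m2 x (h ▸ s1 hx)
    linarith
  have i1 := ih S1 ss1 n1 (fun x hx y hy => hS x (s1 hx) y (s1 hy))
  have i2 := ih S2 ss2 n2 (fun x hx y hy => hS x (s2 hx) y (s2 hy))
  calc ENNReal.ofReal (√(S.card : ℝ)) ≤ ENNReal.ofReal (√(S1.card : ℝ) + √(S2.card : ℝ)) :=
        ENNReal.ofReal_le_ofReal hk
    _ = ENNReal.ofReal (√(S1.card : ℝ)) + ENNReal.ofReal (√(S2.card : ℝ)) :=
        ENNReal.ofReal_add (Real.sqrt_nonneg _) (Real.sqrt_nonneg _)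
    _ ≤ _ := add_le_add i1 i2
    _ ≤ _ := by
        refine cell_split (Set.smul_set_mono (by exact_mod_cast s1))
          (Set.smul_set_mono (by exact_mod_cast s2)) i k ?_ ?_
        · rintro _ ⟨x, hx, rfl⟩
          simpa using m1 x hx
        · rintro _ ⟨x, hx, rfl⟩
          simpa using m2 x hx

/-- If `D` is an ellipsoid in `ℝ^n` containing the unit cube `[0,1]^n`,
then `N(A, D) ≤ Σ(C·A)²`, where `C` is an absolute constant. -/
theorem covering_by_ellipsoid :
    ∃ C > (0 : ℝ), ∀ (n : ℕ) (A D : Set (Fin n → ℝ)),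
      IsEllipsoid D → {x : Fin n → ℝ | ∀ i, 0 ≤ x i ∧ x i ≤ 1} ⊆ D →
      ((coveringNumber A D : ℕ∞) : ℝ≥0∞) ≤ (cellContent (C • A)) ^ 2 := by
  classical
  refine ⟨200, by norm_num, ?_⟩
  rintro n A D ⟨L, z, rfl⟩ hcube
  set T : (Fin n → ℝ) →ₗ[ℝ] (Fin n → ℝ) := L.symm.toLinearMap with hTdef
  have hT : ∀ w : Fin n → ℝ, (∀ i, |w i| ≤ 1/2) → qf T w ≤ 1 := by
    intro w hw
    obtain ⟨p, hp, hpe⟩ := hcube (show (fun i => 1/2 + w i) ∈ _ from fun i => by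
      have := abs_le.1 (hw i); constructor <;> linarith)
    obtain ⟨p', hp', hpe'⟩ := hcube (show (fun i => 1/2 - w i) ∈ _ from fun i => by
      have := abs_le.1 (hw i); constructor <;> linarith)
    simp only [Set.mem_ofPred_eq] at hp hp'
    have e : w = L ((1/2 : ℝ) • (p - p')) := by
      rw [map_smul, map_sub]
      ext i
      have a := congrFun hpe i
      have b := congrFun hpe' i
      simp only [Pi.add_apply] at a b
      simp only [Pi.smul_apply, Pi.sub_apply, smul_eq_mul]
      linarith
    have e2 : T w = (1/2 : ℝ) • (p - p') := by
      rw [e]; simp [hTdef]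
    unfold qf
    rw [e2]
    calc ∑ k, (((1/2 : ℝ) • (p - p')) k) ^ 2 ≤ ∑ k, (1/2 * p k ^ 2 + 1/2 * p' k ^ 2) := by
          refine Finset.sum_le_sum fun k _ => ?_
          simp only [Pi.smul_apply, Pi.sub_apply, smul_eq_mul]
          nlinarith [sq_nonneg (p k + p' k)]
      _ = 1/2 * ∑ k, p k ^ 2 + 1/2 * ∑ k, p' k ^ 2 := by
          rw [Finset.sum_add_distrib, Finset.mul_sum, Finset.mul_sum]
      _ ≤ 1 := by linarith
  by_cases htop : cellContent ((200:ℝ) • A) = ⊤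
  · rw [htop]; simp
  have bound : ∀ S : Finset (Fin n → ℝ), (S : Set (Fin n → ℝ)) ⊆ A → sep T S →
      (S.card : ℝ≥0∞) ≤ cellContent ((200:ℝ) • A) ^ 2 := by
    intro S hSA hS
    rcases S.eq_empty_or_nonempty with rfl | hne
    · simp
    have h := (main_ind hT S hne hS).trans (cellContent_mono (Set.smul_set_mono hSA))
    calc (S.card : ℝ≥0∞) = ENNReal.ofReal (√(S.card : ℝ)) ^ 2 := by
          rw [← ENNReal.ofReal_pow (Real.sqrt_nonneg _), Real.sq_sqrt (Nat.cast_nonneg _)]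
          simp
      _ ≤ _ := by gcongr
  obtain ⟨K, hK⟩ := ENNReal.exists_nat_gt (ENNReal.pow_ne_top (n := 2) htop)
  let P : Set ℕ := {m | ∃ S : Finset (Fin n → ℝ), (S : Set (Fin n → ℝ)) ⊆ A ∧ sep T S ∧ S.card = m}
  have hPne : P.Nonempty := ⟨0, ∅, by simp, by simp [sep], rfl⟩
  have hPb : BddAbove P := by
    refine ⟨K, ?_⟩
    rintro _ ⟨S, hSA, hS, rfl⟩
    exact_mod_cast ((bound S hSA hS).trans hK.le)
  obtain ⟨S, hSA, hS, hcard⟩ := Nat.sSup_mem hPne hPb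
  have hmax : ∀ S' : Finset (Fin n → ℝ), (S' : Set (Fin n → ℝ)) ⊆ A → sep T S' → S'.card ≤ S.card := by
    intro S' h1 h2
    rw [hcard]; exact le_csSup hPb ⟨S', h1, h2, rfl⟩
  have qneg : ∀ x y, qf T (x - y) = qf T (y - x) := by
    intro x y
    have := qf_smul T (-1) (y - x)
    simpa using this
  have hcov : ∀ y ∈ A, ∃ x ∈ S, qf T (y - x) ≤ 1 := by
    intro y hy
    by_contra hc
    push Not at hc
    have hyS : y ∉ S := fun h => by
      have := hc y h
      simp [qf] at this
      linarith
    have := hmax (insert y S) (by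
      rw [Finset.coe_insert]; exact Set.insert_subset hy hSA) (by
      intro a ha b hb hab
      rw [Finset.mem_insert] at ha hb
      rcases ha with rfl | ha <;> rcases hb with rfl | hb
      · exact absurd rfl hab
      · exact hc b hb
      · rw [qneg]; exact hc a ha
      · exact hS a ha b hb hab)
    rw [Finset.card_insert_of_notMem hyS] at this
    omega
  refine le_trans ?_ (bound S hSA hS)
  have : coveringNumber A ((fun x => z + L x) '' {x : Fin n → ℝ | ∑ i, (x i) ^ 2 ≤ 1}) ≤ (S.card : ℕ∞) := by
    refine iInf₂_le S.card ⟨fun j => (S.equivFin.symm j : Fin n → ℝ) - z, ?_⟩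
    intro y hy
    obtain ⟨x, hx, hq⟩ := hcov y hy
    refine Set.mem_iUnion.2 ⟨S.equivFin ⟨x, hx⟩, _, ⟨T (y - x), hq, rfl⟩, ?_⟩
    simp [hTdef]
    abel
  exact_mod_cast this
end

section
/- For every α ≥ 2 and every t ≥ 4, N(Tower^α, t·Q) ≤ exp(C·e^{−α^{t/2}/4}·n), where Q = [0,1]^n and C is an absolute constant. -/
open MeasureTheory Filter
open scoped ENNReal NNReal Pointwise BigOperators

/-- The generating function `θ_α(t) = e^{α^t - α}` for `t ≥ 1` (and `t` for `0 ≤ t < 1`). -/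
noncomputable def towerGen (α : ℝ) (t : ℝ) : ℝ :=
  if t < 1 then t else Real.exp (α ^ t - α)

/-- The Lorentz norm with generating function `φ` of `x ∈ ℝ^n`, with respect to the uniform
probability measure on `{1,…,n}`. -/
noncomputable def lorentzNormFin {n : ℕ} (φ : ℝ → ℝ) (x : Fin n → ℝ) : ℝ :=
  sInf {l : ℝ | 0 < l ∧ ∀ t : ℝ, 0 < t →
    ((Finset.univ.filter fun i => t ≤ |x i| / l).card : ℝ) / n ≤ 1 / φ t}

/-- `Tower^α`: the unit ball of the tower norm in `ℝ^n`. -/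
noncomputable def towerBall (n : ℕ) (α : ℝ) : Set (Fin n → ℝ) :=
  {x | lorentzNormFin (towerGen α) x ≤ 1}

/-- The unit cube `[0,1]^n`. -/
def unitCube (n : ℕ) : Set (Fin n → ℝ) := {x | ∀ i, 0 ≤ x i ∧ x i ≤ 1}

lemma tower_attain {n : ℕ} {α s : ℝ} (hα : 2 ≤ α) (hs : 2 ≤ s) {x : Fin n → ℝ}
    (hx : x ∈ towerBall n α) :
    ((Finset.univ.filter fun i => s ≤ |x i|).card : ℝ) / n ≤ Real.exp (α - α ^ s) := by
  have hne : {l : ℝ | 0 < l ∧ ∀ t : ℝ, 0 < t →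
      ((Finset.univ.filter fun i => t ≤ |x i| / l).card : ℝ) / n ≤ 1 / towerGen α t}.Nonempty := by
    have hS : 0 ≤ ∑ i, |x i| := Finset.sum_nonneg fun i _ => abs_nonneg _
    refine ⟨1 + ∑ i, |x i|, by positivity, fun t ht => ?_⟩
    by_cases h1 : t < 1
    · have h2 : ((Finset.univ.filter fun i => t ≤ |x i| / (1 + ∑ i, |x i|)).card : ℝ) / n ≤ 1 := by
        apply div_le_one_of_le₀ _ (by positivity)
        have := Finset.card_filter_le (Finset.univ : Finset (Fin n))
          (fun i => t ≤ |x i| / (1 + ∑ i, |x i|))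
        simp only [Finset.card_univ, Fintype.card_fin] at this
        exact_mod_cast this
      have h3 : 1 ≤ 1 / towerGen α t := by
        simp only [towerGen, h1, if_true]
        rw [le_div_iff₀ ht]; linarith
      linarith
    · have : (Finset.univ.filter fun i => t ≤ |x i| / (1 + ∑ i, |x i|)) = ∅ := by
        apply Finset.filter_eq_empty_iff.2
        intro i _ h
        have h4 : |x i| ≤ ∑ i, |x i| :=
          Finset.single_le_sum (f := fun i => |x i|) (fun i _ => abs_nonneg _) (Finset.mem_univ i)
        rw [le_div_iff₀ (by positivity)] at h
        nlinarith
      rw [this]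
      simp only [towerGen, h1, if_false]
      simp only [Finset.card_empty, Nat.cast_zero, zero_div]
      positivity
  have key : ∀ l ∈ Set.Ioc (1:ℝ) 2,
      ((Finset.univ.filter fun i => s ≤ |x i|).card : ℝ) / n ≤ Real.exp (α - α ^ (s / l)) := by
    intro l hl
    have hx' : lorentzNormFin (towerGen α) x < l := lt_of_le_of_lt hx hl.1
    obtain ⟨l', ⟨h0, hl'⟩, hlt⟩ := exists_lt_of_csInf_lt hne hx'
    have h1 : 1 ≤ s / l := by
      rw [le_div_iff₀ (by linarith [hl.1])]; linarith [hl.2]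
    have h2 : s / l ≤ s / l' := by
      apply div_le_div_of_nonneg_left (by linarith) h0 hlt.le
    have h3 := hl' (s / l') (by positivity)
    have h4 : ∀ i, s / l' ≤ |x i| / l' ↔ s ≤ |x i| := fun i => div_le_div_iff_of_pos_right h0
    simp only [h4] at h3
    refine h3.trans ?_
    rw [towerGen, if_neg (by linarith), one_div, ← Real.exp_neg]
    apply Real.exp_le_exp.2
    have : α ^ (s / l) ≤ α ^ (s / l') := Real.rpow_le_rpow_of_exponent_le (by linarith) h2
    linarith
  have hlim : Tendsto (fun l : ℝ => Real.exp (α - α ^ (s / l))) (nhdsWithin 1 (Set.Ioi 1))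
      (nhds (Real.exp (α - α ^ s))) := by
    have : ContinuousAt (fun l : ℝ => Real.exp (α - α ^ (s / l))) 1 := by
      refine Real.continuous_exp.continuousAt.comp (ContinuousAt.sub continuousAt_const ?_)
      refine ContinuousAt.rpow continuousAt_const
        (ContinuousAt.div continuousAt_const continuousAt_id (by norm_num)) (Or.inl (by linarith))
    have h := this.tendsto
    simp only [div_one] at h
    exact h.mono_left nhdsWithin_le_nhds
  refine ge_of_tendsto hlim ?_
  filter_upwards [Ioc_mem_nhdsGT (show (1:ℝ) < 2 by norm_num)] with l hl using key l hl

lemma coveringNumber_le_card {n : ℕ} (K D : Set (Fin n → ℝ)) (S : Finset (Fin n → ℤ))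
    (c : (Fin n → ℤ) → Fin n → ℝ) (h : ∀ x ∈ K, ∃ k ∈ S, x ∈ (fun y => c k + y) '' D) :
    coveringNumber K D ≤ (S.card : ℕ∞) := by
  refine iInf₂_le S.card ⟨fun j => c (S.equivFin.symm j), fun x hx => ?_⟩
  obtain ⟨k, hk, hxk⟩ := h x hx
  refine Set.mem_iUnion.2 ⟨S.equivFin ⟨k, hk⟩, ?_⟩
  simpa using hxk

/-- weights -/
noncomputable def bw (α t : ℝ) (j : ℕ) : ℝ := α ^ (t * (j + 1 / 2)) / 4

noncomputable def wt (α t : ℝ) (k : ℤ) : ℝ := if k = 0 then 0 else bw α t (k.natAbs - 1)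

lemma bw_zero (α t : ℝ) : bw α t 0 = α ^ (t / 2) / 4 := by
  simp only [bw]; congr 2; push_cast; ring

lemma bw_nonneg {α t : ℝ} (hα : 2 ≤ α) (j : ℕ) : 0 ≤ bw α t j := by
  unfold bw; positivity

lemma one_le_bw_zero {α t : ℝ} (hα : 2 ≤ α) (ht : 4 ≤ t) : 1 ≤ bw α t 0 := by
  rw [bw_zero]
  have h1 : α ^ (2:ℝ) ≤ α ^ (t / 2) :=
    Real.rpow_le_rpow_of_exponent_le (by linarith) (by linarith)
  rw [Real.rpow_two] at h1
  nlinarith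

lemma bw_ge {α t : ℝ} (hα : 2 ≤ α) (ht : 4 ≤ t) (j : ℕ) : bw α t 0 + j ≤ bw α t j := by
  have h0 := one_le_bw_zero hα ht
  have h1 : bw α t j = bw α t 0 * α ^ (t * j) := by
    rw [bw_zero, bw, div_mul_eq_mul_div, ← Real.rpow_add (by linarith)]
    congr 2; ring
  have h2 : (1 + j : ℝ) ≤ α ^ (t * j) := by
    have h3 : α ^ (j : ℝ) ≤ α ^ (t * j) :=
      Real.rpow_le_rpow_of_exponent_le (by linarith)
        (by nlinarith [Nat.cast_nonneg (α := ℝ) j])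
    rw [Real.rpow_natCast] at h3
    have h4 : (2:ℝ) ^ j ≤ α ^ j := pow_le_pow_left₀ (by norm_num) hα j
    have h5 := one_add_mul_le_pow (show (-2:ℝ) ≤ 1 by norm_num) j
    norm_num at h5
    linarith
  rw [h1]
  nlinarith [Nat.cast_nonneg (α := ℝ) j]

lemma alpha_le {α t : ℝ} (hα : 2 ≤ α) (ht : 4 ≤ t) (j : ℕ) :
    α - α ^ (t * (j + 1 / 2)) ≤ - (2 * bw α t j) := by
  have h1 : α ^ (2:ℝ) ≤ α ^ (t * (j + 1 / 2)) :=
    Real.rpow_le_rpow_of_exponent_le (by linarith) (by nlinarith [Nat.cast_nonneg (α := ℝ) j])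
  rw [Real.rpow_two] at h1
  unfold bw
  nlinarith

lemma sum_exp_bw {α t : ℝ} (hα : 2 ≤ α) (ht : 4 ≤ t) (M : ℕ) :
    ∑ j ∈ Finset.range M, Real.exp (-bw α t j) ≤ 2 * Real.exp (-bw α t 0) := by
  calc _ ≤ ∑ j ∈ Finset.range M, Real.exp (-bw α t 0) * (1 / 2 : ℝ) ^ j := by
        apply Finset.sum_le_sum
        intro j _
        have h1 : Real.exp (-bw α t j) ≤ Real.exp (-bw α t 0) * Real.exp (-1) ^ j := by
          rw [← Real.exp_nat_mul, ← Real.exp_add]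
          apply Real.exp_le_exp.2
          linarith [bw_ge hα ht j]
        have h2 : Real.exp (-1) ≤ 1 / 2 := by
          rw [Real.exp_neg, ← one_div]
          exact one_div_le_one_div_of_le (by norm_num) (by linarith [Real.add_one_le_exp 1])
        refine h1.trans ?_
        gcongr
    _ ≤ _ := by
        rw [← Finset.mul_sum, mul_comm]
        gcongr
        have := sum_geometric_two_le M
        simpa using this

lemma sum_exp_wt (α t : ℝ) (M : ℕ) :
    ∑ k ∈ Finset.Icc (-(M:ℤ)) M, Real.exp (-wt α t k) ≤
      1 + 2 * ∑ j ∈ Finset.range M, Real.exp (-bw α t j) := by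
  induction M with
  | zero => simp [wt]
  | succ m ih =>
    have : Finset.Icc (-((m+1 : ℕ):ℤ)) ((m+1 : ℕ):ℤ) =
        insert (-((m+1 : ℕ):ℤ)) (insert ((m+1 : ℕ):ℤ) (Finset.Icc (-(m:ℤ)) m)) := by
      ext k; simp only [Finset.mem_insert, Finset.mem_Icc]; omega
    rw [this, Finset.sum_insert, Finset.sum_insert, Finset.sum_range_succ]
    · have e1 : wt α t (-((m+1 : ℕ):ℤ)) = bw α t m := by
        rw [wt, if_neg (by omega)]; congr 1
      have e2 : wt α t (((m+1 : ℕ):ℤ)) = bw α t m := by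
        rw [wt, if_neg (by omega)]; congr 1
      rw [e1, e2]; linarith
    · simp only [Finset.mem_Icc]; omega
    · simp only [Finset.mem_insert, Finset.mem_Icc]; omega

lemma abs_ge_of_round {t y : ℝ} (ht : 4 ≤ t) (j : ℕ) (h : j + 1 ≤ (round (y / t)).natAbs) :
    t * (j + 1 / 2) ≤ |y| := by
  have h1 := abs_sub_round (y / t)
  have h2 : ((j:ℝ) + 1) ≤ |((round (y / t) : ℤ) : ℝ)| := by
    rw [← Int.cast_abs, ← Int.natCast_natAbs]
    exact_mod_cast h
  have h3 : |((round (y / t) : ℤ) : ℝ)| ≤ |y / t| + |y / t - round (y / t)| := by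
    rw [abs_sub_comm]
    have := abs_add_le (y / t) (round (y / t) - y / t)
    simpa using this
  rw [abs_div, abs_of_pos (show 0 < t by linarith)] at h3
  have h4 : (j : ℝ) + 1 / 2 ≤ |y| / t := by linarith
  rw [le_div_iff₀ (by linarith)] at h4
  linarith

lemma card_round {n : ℕ} {α t : ℝ} (hα : 2 ≤ α) (ht : 4 ≤ t) {x : Fin n → ℝ}
    (hx : x ∈ towerBall n α) (j : ℕ) :
    ((Finset.univ.filter fun i => j + 1 ≤ (round (x i / t)).natAbs).card : ℝ) ≤
      n * Real.exp (-(2 * bw α t j)) := by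
  have hs : 2 ≤ t * ((j:ℝ) + 1 / 2) := by nlinarith [Nat.cast_nonneg (α := ℝ) j]
  have h1 := tower_attain hα hs hx
  have h2 : ((Finset.univ.filter fun i => j + 1 ≤ (round (x i / t)).natAbs).card : ℝ) ≤
      (Finset.univ.filter fun i => t * ((j:ℝ) + 1 / 2) ≤ |x i|).card := by
    norm_cast
    apply Finset.card_le_card
    intro i
    simp only [Finset.mem_filter, Finset.mem_univ, true_and]
    exact abs_ge_of_round ht j
  rcases Nat.eq_zero_or_pos n with rfl | hn
  · simp
  · have hn' : (0:ℝ) < n := by exact_mod_cast hn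
    rw [div_le_iff₀ hn'] at h1
    have h3 := Real.exp_le_exp.2 (alpha_le hα ht j)
    nlinarith

lemma natAbs_round_le {n : ℕ} {α t : ℝ} (hα : 2 ≤ α) (ht : 4 ≤ t) {x : Fin n → ℝ}
    (hx : x ∈ towerBall n α) (i : Fin n) : (round (x i / t)).natAbs ≤ n := by
  by_contra! h
  have h1 := card_round hα ht hx n
  have h2 : 1 ≤ (Finset.univ.filter fun i => n + 1 ≤ (round (x i / t)).natAbs).card := by
    apply Finset.card_pos.2
    exact ⟨i, by simpa using h⟩
  have h3 : (1:ℝ) ≤ n * Real.exp (-(2 * bw α t n)) := le_trans (by exact_mod_cast h2) h1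
  have h4 := bw_ge hα ht n
  have h5 := one_le_bw_zero hα ht
  have h6 : Real.exp (-(2 * bw α t n)) ≤ Real.exp (-(n:ℝ)) :=
    Real.exp_le_exp.2 (by linarith [Nat.cast_nonneg (α := ℝ) n])
  have h7 : (n:ℝ) * Real.exp (-(n:ℝ)) < 1 := by
    rw [Real.exp_neg, ← div_eq_mul_inv, div_lt_one (Real.exp_pos _)]
    linarith [Real.add_one_le_exp (n:ℝ)]
  nlinarith [Nat.cast_nonneg (α := ℝ) n]

lemma sum_wt_le {n : ℕ} {α t : ℝ} (hα : 2 ≤ α) (ht : 4 ≤ t) {x : Fin n → ℝ}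
    (hx : x ∈ towerBall n α) :
    ∑ i, wt α t (round (x i / t)) ≤ n * ∑ j ∈ Finset.range n, Real.exp (-bw α t j) := by
  calc ∑ i, wt α t (round (x i / t))
      ≤ ∑ i, ∑ j ∈ Finset.range n,
        if j + 1 ≤ (round (x i / t)).natAbs then bw α t j else 0 := by
        apply Finset.sum_le_sum
        intro i _
        have hnn : ∀ j ∈ Finset.range n,
            0 ≤ if j + 1 ≤ (round (x i / t)).natAbs then bw α t j else 0 := by
          intro j _
          split_ifs
          · exact bw_nonneg hα j
          · exact le_rfl
        unfold wt
        split_ifs with h0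
        · exact Finset.sum_nonneg hnn
        · have hb := natAbs_round_le hα ht hx i
          have := Finset.single_le_sum hnn (a := (round (x i / t)).natAbs - 1)
            (by rw [Finset.mem_range]; omega)
          rw [if_pos (by omega)] at this
          exact this
    _ = ∑ j ∈ Finset.range n,
          ((Finset.univ.filter fun i => j + 1 ≤ (round (x i / t)).natAbs).card : ℝ) * bw α t j := by
        rw [Finset.sum_comm]
        apply Finset.sum_congr rfl
        intro j _
        rw [← Finset.sum_filter, Finset.sum_const, nsmul_eq_mul]
    _ ≤ _ := by
        rw [Finset.mul_sum]
        apply Finset.sum_le_sum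
        intro j _
        have h1 := card_round hα ht hx j
        have h2 := bw_nonneg (t := t) hα j
        have h3 : bw α t j ≤ Real.exp (bw α t j) := by linarith [Real.add_one_le_exp (bw α t j)]
        calc _ ≤ (n * Real.exp (-(2 * bw α t j))) * Real.exp (bw α t j) := by gcongr
          _ = _ := by
            rw [mul_assoc, ← Real.exp_add]; congr 2; ring

/-- For every `α ≥ 2` and every `t ≥ 4`,
`N(Tower^α, t·Q) ≤ exp(C·e^{−α^{t/2}/4}·n)`, where `Q = [0,1]^n`. -/
theorem covering_tower_by_cubes :
    ∃ C > (0 : ℝ), ∀ (n : ℕ) (α t : ℝ), 2 ≤ α → 4 ≤ t →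
      ((coveringNumber (towerBall n α) (t • unitCube n) : ℕ∞) : ℝ≥0∞) ≤
        ENNReal.ofReal (Real.exp (C * Real.exp (-(α ^ (t / 2)) / 4) * n)) := by
  refine ⟨6, by norm_num, fun n α t hα ht => ?_⟩
  set G := ∑ j ∈ Finset.range n, Real.exp (-bw α t j) with hG
  have hG2 : G ≤ 2 * Real.exp (-bw α t 0) := sum_exp_bw hα ht n
  let P : Finset (Fin n → ℤ) := Fintype.piFinset fun _ => Finset.Icc (-(n:ℤ)) n
  let S : Finset (Fin n → ℤ) := P.filter fun k => ∑ i, wt α t (k i) ≤ n * G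
  have hcov : coveringNumber (towerBall n α) (t • unitCube n) ≤ (S.card : ℕ∞) := by
    apply coveringNumber_le_card _ _ S (fun k i => t * k i - t / 2)
    intro x hx
    refine ⟨fun i => round (x i / t), ?_, ?_⟩
    · refine Finset.mem_filter.2 ⟨Fintype.mem_piFinset.2 fun i => ?_, sum_wt_le hα ht hx⟩
      have := natAbs_round_le hα ht hx i
      rw [Finset.mem_Icc]; omega
    · have ht0 : t ≠ 0 := by linarith
      refine ⟨fun i => x i - (t * (round (x i / t) : ℤ) - t / 2), ?_, by ext i; simp⟩
      refine ⟨fun i => x i / t - (round (x i / t) : ℤ) + 1 / 2, fun i => ?_, ?_⟩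
      · have := abs_le.1 (abs_sub_round (x i / t))
        constructor <;> linarith [this.1, this.2]
      · ext i
        simp only [Pi.smul_apply, smul_eq_mul]
        field_simp
        ring
  have hcard : (S.card : ℝ) ≤ Real.exp (6 * Real.exp (-(α ^ (t / 2)) / 4) * n) := by
    calc (S.card : ℝ) = ∑ k ∈ S, (1:ℝ) := by simp
      _ ≤ ∑ k ∈ S, Real.exp (n * G) * ∏ i, Real.exp (-wt α t (k i)) := by
          apply Finset.sum_le_sum
          intro k hk
          have := (Finset.mem_filter.1 hk).2
          rw [← Real.exp_sum, ← Real.exp_add, Finset.sum_neg_distrib]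
          apply Real.one_le_exp
          linarith
      _ ≤ ∑ k ∈ P, Real.exp (n * G) * ∏ i, Real.exp (-wt α t (k i)) := by
          apply Finset.sum_le_sum_of_subset_of_nonneg (Finset.filter_subset _ _)
          intro k _ _
          positivity
      _ = Real.exp (n * G) * (∑ k ∈ Finset.Icc (-(n:ℤ)) n, Real.exp (-wt α t k)) ^ n := by
          rw [← Finset.mul_sum]
          congr 1
          have h := Finset.prod_univ_sum (fun _ : Fin n => Finset.Icc (-(n:ℤ)) n)
            (fun _ k => Real.exp (-wt α t k))
          rw [← h]
          simp
      _ ≤ Real.exp (n * G) * (Real.exp (2 * G)) ^ n := by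
          gcongr
          refine (sum_exp_wt α t n).trans ?_
          linarith [Real.add_one_le_exp (2 * G)]
      _ ≤ _ := by
          rw [← Real.exp_nat_mul, ← Real.exp_add]
          apply Real.exp_le_exp.2
          have : -(α ^ (t / 2)) / 4 = -bw α t 0 := by rw [bw_zero]; ring
          rw [this]
          nlinarith [Nat.cast_nonneg (α := ℝ) n]
  calc ((coveringNumber (towerBall n α) (t • unitCube n) : ℕ∞) : ℝ≥0∞)
      ≤ (((S.card : ℕ∞)) : ℝ≥0∞) := by exact_mod_cast hcov
    _ = ENNReal.ofReal (S.card : ℝ) := by simp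
    _ ≤ _ := ENNReal.ofReal_le_ofReal hcard
end

section
/- Let F be a class of real-valued functions on an n-point set Ω with the uniform probability measure μ, and assume F is 1-bounded in L₁(Ω,μ), i.e. ∫|f| dμ ≤ 1 for all f ∈ F. Then for every 0 < ε < 1 and every 0 < t < 1/2, D_∞(F, t) ≤ C·v·log(n/(v t))·(log(2n/v))^ε, where v = v(F, c·ε·t) and C, c > 0 are absolute constants. -/
open MeasureTheory Filter
open scoped ENNReal NNReal Pointwise BigOperators

/-- A finite subset `σ` of `Ω` is `t`-shattered by the class `F`: there is a level function `h`
such that for every partition of `σ` (given by the subset `τ = σ₊`) some `f ∈ F` lies below `h`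
on `σ₋ = σ \ τ` and above `h + t` on `σ₊ = τ`. -/
def Shatters {Ω : Type*} (F : Set (Ω → ℝ)) (t : ℝ) (σ : Finset Ω) : Prop :=
  ∃ h : Ω → ℝ, ∀ τ : Finset Ω, τ ⊆ σ →
    ∃ f ∈ F, (∀ x ∈ σ, x ∉ τ → f x ≤ h x) ∧ (∀ x ∈ τ, h x + t ≤ f x)

/-- The combinatorial dimension `v(F,t)`: the maximal cardinality of a `t`-shattered set. -/
noncomputable def combDim {Ω : Type*} (F : Set (Ω → ℝ)) (t : ℝ) : ℝ≥0∞ :=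
  ⨆ (σ : Finset Ω) (_ : Shatters F t σ), (σ.card : ℝ≥0∞)

/-- There are `m` functions in `F` that are pairwise `t`-separated in `L₂(μ)` for some
probability measure `μ` supported on a finite subset of `Ω` (given by weights `w` on `s`). -/
def KPSeparated {Ω : Type*} (F : Set (Ω → ℝ)) (t : ℝ) (m : ℕ) : Prop :=
  ∃ (s : Finset Ω) (w : Ω → ℝ) (f : Fin m → Ω → ℝ),
    (∀ x, 0 ≤ w x) ∧ (∑ x ∈ s, w x = 1) ∧ (∀ i, f i ∈ F) ∧
    ∀ i j : Fin m, i < j → t ^ 2 ≤ ∑ x ∈ s, w x * (f i x - f j x) ^ 2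

/-- The Koltchinskii–Pollard entropy `D(F,t) = log sup { m : KPSeparated F t m }`. -/
noncomputable def KPentropy {Ω : Type*} (F : Set (Ω → ℝ)) (t : ℝ) : ℝ≥0∞ :=
  ⨆ (m : ℕ) (_ : KPSeparated F t m), ENNReal.ofReal (Real.log m)

/-- The `L∞` entropy `D_∞(F,t)`: the logarithm of the maximal number of functions in `F`
that are pairwise `t`-separated in the sup-norm. -/
noncomputable def DInfty {Ω : Type*} (F : Set (Ω → ℝ)) (t : ℝ) : ℝ≥0∞ :=
  ⨆ (m : ℕ) (_ : ∃ f : Fin m → Ω → ℝ, (∀ i, f i ∈ F) ∧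
      ∀ i j : Fin m, i < j → ∃ ω, t ≤ |f i ω - f j ω|),
    ENNReal.ofReal (Real.log m)

lemma geom_int_bound (q : ℝ) (h0 : 0 < q) (h1 : q < 1) (U : Finset ℤ) :
    ∑ k ∈ U, q ^ k.natAbs ≤ 2 / (1 - q) := by
  have ha : HasSum (fun n : ℕ => q ^ ((n : ℤ)).natAbs) (1 - q)⁻¹ := by
    simpa using hasSum_geometric_of_lt_one h0.le h1
  have hb : HasSum (fun n : ℕ => q ^ (-((n : ℤ) + 1)).natAbs) (q * (1 - q)⁻¹) := by
    have := (hasSum_geometric_of_lt_one h0.le h1).mul_left q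
    refine this.congr_fun ?_ |> fun h => h
    intro n
    have : (-((n : ℤ) + 1)).natAbs = n + 1 := by omega
    rw [this, pow_succ']
  have h := HasSum.of_nat_of_neg_add_one (f := fun k : ℤ => q ^ k.natAbs) ha hb
  refine (sum_le_hasSum U (fun k _ => by positivity) h).trans ?_
  have : 0 < 1 - q := by linarith
  rw [div_eq_mul_inv, ← one_add_mul]
  gcongr
  linarith

def osupp {n : ℕ} (g : Fin n → Option ℤ) : Finset (Fin n) :=
  Finset.univ.filter (fun i => g i ≠ none)

def oabs (o : Option ℤ) : ℕ := (o.getD 0).natAbs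

lemma count_bound (n d : ℕ) (N : ℝ) (hd : 1 ≤ d) (hdn : d ≤ n) (hN : (n : ℝ) ≤ N)
    (S : Finset (Fin n → Option ℤ))
    (h1 : ∀ g ∈ S, (osupp g).card ≤ d)
    (h2 : ∀ g ∈ S, (∑ i, (oabs (g i) : ℝ)) ≤ N) :
    (S.card : ℝ) ≤ Real.exp (d * (5 + Real.log (n / d) + Real.log (N / d))) := by
  classical
  have hdr : (1 : ℝ) ≤ d := by exact_mod_cast hd
  have hdnr : (d : ℝ) ≤ n := by exact_mod_cast hdn
  have hNpos : 0 < N := by linarith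
  have hnpos : (0 : ℝ) < n := by linarith
  set μ : ℝ := d / N with hμ
  have hμ0 : 0 < μ := by positivity
  have hμ1 : μ ≤ 1 := by rw [hμ, div_le_one hNpos]; linarith
  set lam : ℝ := μ * (d / n) with hlam
  have hdn1 : (d : ℝ) / n ≤ 1 := by rw [div_le_one hnpos]; exact hdnr
  have hl0 : 0 < lam := by positivity
  have hl1 : lam ≤ 1 := by
    calc lam ≤ 1 * 1 := by rw [hlam]; gcongr
      _ = 1 := by ring
  set q : ℝ := Real.exp (-μ) with hq
  have hq0 : 0 < q := Real.exp_pos _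
  have hq1 : q < 1 := by rw [hq, Real.exp_lt_one_iff]; linarith
  have hq2 : μ / 2 ≤ 1 - q := by
    have : q ≤ 1 / (1 + μ) := by
      rw [hq, Real.exp_neg, ← one_div]
      apply one_div_le_one_div_of_le (by linarith)
      linarith [Real.add_one_le_exp μ]
    have h3 : 1 / (1 + μ) ≤ 1 - μ / 2 := by
      rw [div_le_iff₀ (by linarith)]; nlinarith
    linarith
  let w : Option ℤ → ℝ := fun o => o.elim 1 (fun k => lam * q ^ k.natAbs)
  have hw0 : ∀ o, 0 ≤ w o := by
    intro o; cases o <;> simp [w] <;> positivity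
  have hlow : ∀ g ∈ S, lam ^ d * Real.exp (-d) ≤ ∏ i, w (g i) := by
    intro g hg
    have e : ∏ i, w (g i) = lam ^ (osupp g).card * q ^ (∑ i, oabs (g i)) := by
      have : ∀ i, w (g i) = (if g i ≠ none then lam else 1) * q ^ (oabs (g i)) := by
        intro i
        cases h : g i <;> simp [w, oabs]
      simp_rw [this]
      rw [Finset.prod_mul_distrib, Finset.prod_pow_eq_pow_sum, Finset.prod_ite]
      simp [osupp]
    rw [e]
    have e2 : Real.exp (-d) ≤ q ^ (∑ i, oabs (g i)) := by
      rw [hq, ← Real.exp_nat_mul, Real.exp_le_exp]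
      have := h2 g hg
      push_cast
      have h3 : μ * (∑ i, (oabs (g i) : ℝ)) ≤ μ * N := by gcongr
      have h4 : μ * N = d := by rw [hμ]; field_simp
      linarith
    have e3 : lam ^ d ≤ lam ^ (osupp g).card :=
      pow_le_pow_of_le_one hl0.le hl1 (h1 g hg)
    gcongr
  let V : Finset (Option ℤ) := S.biUnion (fun g => Finset.univ.image g)
  have hsub : S ⊆ Fintype.piFinset (fun _ : Fin n => V) := by
    intro g hg
    rw [Fintype.mem_piFinset]
    intro i
    simp only [V, Finset.mem_biUnion, Finset.mem_image]
    exact ⟨g, hg, i, Finset.mem_univ _, rfl⟩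
  have hV : ∑ o ∈ V, w o ≤ 1 + 4 * (d / n) := by
    calc ∑ o ∈ V, w o ≤ ∑ o ∈ Finset.insertNone (Finset.eraseNone V), w o := by
          apply Finset.sum_le_sum_of_subset_of_nonneg
          · intro o ho
            cases o <;> simp [ho]
          · intro o _ _; exact hw0 o
      _ = 1 + lam * ∑ k ∈ Finset.eraseNone V, q ^ k.natAbs := by
          rw [Finset.sum_insertNone, Finset.mul_sum]; rfl
      _ ≤ 1 + lam * (4 / μ) := by
          have := geom_int_bound q hq0 hq1 (Finset.eraseNone V)
          have h4 : 2 / (1 - q) ≤ 4 / μ := by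
            rw [div_le_div_iff₀ (by linarith) hμ0]; linarith
          have := this.trans h4
          gcongr
      _ = _ := by rw [hlam]; field_simp
  have htot : (S.card : ℝ) * (lam ^ d * Real.exp (-d)) ≤ Real.exp (4 * d) := by
    calc (S.card : ℝ) * (lam ^ d * Real.exp (-d)) ≤ ∑ g ∈ S, ∏ i, w (g i) := by
          rw [← nsmul_eq_mul]; exact Finset.card_nsmul_le_sum _ _ _ hlow
      _ ≤ ∑ g ∈ Fintype.piFinset (fun _ : Fin n => V), ∏ i, w (g i) :=
          Finset.sum_le_sum_of_subset_of_nonneg hsub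
            (fun g _ _ => Finset.prod_nonneg (fun i _ => hw0 _))
      _ = ∏ i : Fin n, ∑ o ∈ V, w o := (Finset.prod_univ_sum _ _).symm
      _ = (∑ o ∈ V, w o) ^ n := by simp
      _ ≤ (Real.exp (4 * (d / n))) ^ n := by
          apply pow_le_pow_left₀ (Finset.sum_nonneg (fun o _ => hw0 o))
          linarith [Real.add_one_le_exp (4 * ((d : ℝ) / n))]
      _ = Real.exp (4 * d) := by
          rw [← Real.exp_nat_mul]; congr 1; field_simp
  have hlamexp : lam ^ d = Real.exp (-(d * (Real.log (n / d) + Real.log (N / d)))) := by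
    have : Real.log (n / d) + Real.log (N / d) = - Real.log lam := by
      rw [← Real.log_mul (by positivity) (by positivity), ← Real.log_inv]
      congr 1
      rw [hlam, hμ]; field_simp
    rw [this, mul_neg, neg_neg, Real.exp_nat_mul, Real.exp_log hl0]
  rw [hlamexp, ← Real.exp_add, ← le_div_iff₀ (Real.exp_pos _), ← Real.exp_sub] at htot
  refine htot.trans (Real.exp_le_exp.mpr ?_)
  linarith

lemma chain (p : ℕ → ℝ) (L : ℕ) (hL : 1 ≤ L) (R β : ℝ) (hR : 1 ≤ R) (hβ : 1 ≤ β)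
    (hlog : Real.log (8 * R) ≤ β ^ L * Real.log 2)
    (hpos : ∀ j ≤ L, 0 < p j) (h0 : p 0 ≤ 1 / 2) (hpL : 1 / (8 * R) ≤ p L) :
    ∃ j < L, - Real.log (p (j + 1)) ≤ β * (- Real.log (p j)) := by
  by_contra! H
  have key : ∀ j ≤ L, β ^ j * Real.log 2 ≤ - Real.log (p j) ∧
      (1 ≤ j → β ^ j * Real.log 2 < - Real.log (p j)) := by
    intro j
    induction j with
    | zero =>
      intro _
      refine ⟨?_, by omega⟩
      have := Real.log_le_log (hpos 0 (by omega)) h0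
      rw [one_div, Real.log_inv] at this
      simp; linarith
    | succ k ih =>
      intro hk
      have h1 := (ih (by omega)).1
      have h2 := H k (by omega)
      have h3 : β * (β ^ k * Real.log 2) ≤ β * (- Real.log (p k)) := by gcongr
      have h4 : β ^ (k + 1) * Real.log 2 < - Real.log (p (k + 1)) := by
        rw [pow_succ']; linarith
      exact ⟨h4.le, fun _ => h4⟩
  have h1 := (key L le_rfl).2 hL
  have h2 := Real.log_le_log (by positivity) hpL
  rw [one_div, Real.log_inv] at h2
  linarith

lemma splitU {ι : Type*} [DecidableEq ι] (B : Finset ι) (U : ℕ → Finset ι) (L : ℕ)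
    (hL : 1 ≤ L) (R β : ℝ)
    (hR : 1 ≤ R) (hβ : 1 ≤ β) (hlog : Real.log (8 * R) ≤ β ^ L * Real.log 2)
    (hB : B.Nonempty) (hU : ∀ j, U j ⊆ B) (hanti : Antitone U)
    (h0 : 2 * ((U 0).card : ℝ) ≤ B.card) (hUL : (B.card : ℝ) / (8 * R) ≤ (U L).card) :
    ∃ j, (B \ U j).Nonempty ∧ (U (j + 1)).Nonempty ∧
      (B.card : ℝ) ^ (1 / β) ≤ ((B \ U j).card : ℝ) ^ (1 / β) +
        ((U (j + 1)).card : ℝ) ^ (1 / β) := by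
  have hb : (0 : ℝ) < B.card := by exact_mod_cast hB.card_pos
  have hULpos : (0 : ℝ) < (U L).card := lt_of_lt_of_le (by positivity) hUL
  have hUpos : ∀ j ≤ L, (0 : ℝ) < (U j).card := fun j hj =>
    lt_of_lt_of_le hULpos (by exact_mod_cast Finset.card_le_card (hanti hj))
  obtain ⟨j, hj, hjl⟩ := chain (fun j => ((U j).card : ℝ) / B.card) L hL R β hR hβ hlog
    (fun j hj => div_pos (hUpos j hj) hb) (by
      rw [div_le_iff₀ hb]; linarith) (by
      rw [le_div_iff₀ hb]; calc _ = (B.card : ℝ) / (8 * R) := by ring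
        _ ≤ _ := hUL)
  have hc : ((B \ U j).card : ℝ) = B.card - (U j).card := by
    rw [Finset.card_sdiff_of_subset (hU j), Nat.cast_sub (Finset.card_le_card (hU j))]
  have hj0 : ((U j).card : ℝ) ≤ (U 0).card := by
    exact_mod_cast Finset.card_le_card (hanti (Nat.zero_le j))
  have hcpos : 0 < ((B \ U j).card : ℝ) := by rw [hc]; linarith
  refine ⟨j, ?_, ?_, ?_⟩
  · rw [← Finset.card_pos]; exact_mod_cast hcpos
  · rw [← Finset.card_pos]; exact_mod_cast hUpos (j + 1) hj
  · set x := ((U j).card : ℝ) / B.card with hx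
    set y := ((U (j + 1)).card : ℝ) / B.card with hy
    have hx0 : 0 < x := div_pos (hUpos j hj.le) hb
    have hy0 : 0 < y := div_pos (hUpos (j + 1) hj) hb
    have hx1 : x ≤ 1 / 2 := by rw [hx, div_le_iff₀ hb]; linarith
    have hβ0 : 0 < β := by linarith
    have e1 : x ≤ y ^ (1 / β) := by
      rw [← Real.log_le_log_iff hx0 (by positivity), Real.log_rpow hy0, one_div,
        ← div_eq_inv_mul, le_div_iff₀ hβ0]
      linarith
    have e2 : 1 - x ≤ (1 - x) ^ (1 / β) := by
      apply Real.self_le_rpow_of_le_one (by linarith) (by linarith)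
      rw [div_le_one hβ0]; exact hβ
    have f1 : ((U (j + 1)).card : ℝ) = B.card * y := (mul_div_cancel₀ _ hb.ne').symm
    have f2 : ((B \ U j).card : ℝ) = B.card * (1 - x) := by
      rw [hc, mul_sub, mul_one, hx, mul_div_cancel₀ _ hb.ne']
    rw [f1, f2, Real.mul_rpow hb.le (by linarith), Real.mul_rpow hb.le hy0.le, ← mul_add]
    exact le_mul_of_one_le_right (Real.rpow_nonneg hb.le _) (by linarith)

lemma oneDim {ι : Type*} (B : Finset ι) (X : ι → ℝ) (L : ℕ) (hL : 1 ≤ L) (R β : ℝ)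
    (hR : 1 ≤ R) (hβ : 1 ≤ β) (hlog : Real.log (8 * R) ≤ β ^ L * Real.log 2)
    (hB : B.Nonempty)
    (hcount : (B.card : ℝ) ^ 2 / (2 * R) ≤
      (((B ×ˢ B).filter (fun p => 5 * (L : ℝ) ≤ |X p.1 - X p.2|)).card : ℝ)) :
    ∃ a : ℤ, (B.filter (fun x => X x ≤ a)).Nonempty ∧
      (B.filter (fun x => (a : ℝ) + 1 ≤ X x)).Nonempty ∧
      (B.card : ℝ) ^ (1 / β) ≤ ((B.filter (fun x => X x ≤ a)).card : ℝ) ^ (1 / β) +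
        ((B.filter (fun x => (a : ℝ) + 1 ≤ X x)).card : ℝ) ^ (1 / β) := by
  classical
  have hb : (0 : ℝ) < B.card := by exact_mod_cast hB.card_pos
  have hβ0 : 0 < β := by linarith
  have hL1 : (1 : ℝ) ≤ L := by exact_mod_cast hL
  -- integer median
  obtain ⟨k, hk, hkmax⟩ : ∃ k : ℤ, B.card ≤ 2 * (B.filter (fun x => (k : ℝ) ≤ X x)).card ∧
      ∀ z : ℤ, B.card ≤ 2 * (B.filter (fun x => (z : ℝ) ≤ X x)).card → z ≤ k := by
    apply Int.exists_greatest_of_bdd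
    · obtain ⟨M, hM⟩ : ∃ M : ℝ, ∀ x ∈ B, X x ≤ M := by
        obtain ⟨x, hx, h⟩ := B.exists_max_image X hB
        exact ⟨X x, h⟩
      refine ⟨⌊M⌋, fun z hz => ?_⟩
      rw [Int.le_floor]
      have : 0 < (B.filter (fun x => (z : ℝ) ≤ X x)).card := by
        have := hB.card_pos; omega
      obtain ⟨x, hx⟩ := Finset.card_pos.mp this
      rw [Finset.mem_filter] at hx
      exact hx.2.trans (hM x hx.1)
    · obtain ⟨x, hx, h⟩ := B.exists_min_image X hB
      refine ⟨⌊X x⌋, ?_⟩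
      rw [Finset.filter_true_of_mem (fun y hy => (Int.floor_le _).trans (h y hy))]
      omega
  have hup0 : 2 * (B.filter (fun x => (k : ℝ) + 1 ≤ X x)).card ≤ B.card := by
    by_contra! h
    have := hkmax (k + 1) (by push_cast; exact h.le)
    omega
  have hdn0 : 2 * (B.filter (fun x => X x < k)).card ≤ B.card := by
    have := Finset.card_filter_add_card_filter_not (s := B) (fun x => (k : ℝ) ≤ X x)
    simp only [not_le] at this
    omega
  let Up : ℕ → Finset ι := fun j => B.filter (fun x => (k : ℝ) + 1 + j ≤ X x)
  let Dn : ℕ → Finset ι := fun j => B.filter (fun x => X x ≤ (k : ℝ) - 1 - j)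
  have hcov : ((B ×ˢ B).filter (fun p => 5 * (L : ℝ) ≤ |X p.1 - X p.2|)) ⊆
      ((Up L ∪ Dn L) ×ˢ B) ∪ (B ×ˢ (Up L ∪ Dn L)) := by
    rintro ⟨x, y⟩ hxy
    simp only [Finset.mem_filter, Finset.mem_product] at hxy
    obtain ⟨⟨hx, hy⟩, h⟩ := hxy
    simp only [Finset.mem_union, Finset.mem_product, Up, Dn, Finset.mem_filter, hx, hy, true_and,
      and_true]
    by_contra! hcon
    obtain ⟨⟨h1, h2⟩, h3, h4⟩ := hcon
    have : |X x - X y| < 5 * L := by rw [abs_lt]; constructor <;> linarith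
    linarith
  have hcard : (B.card : ℝ) / (4 * R) ≤ (Up L).card + (Dn L).card := by
    have h1 := Finset.card_le_card hcov
    have h2 := h1.trans (Finset.card_union_le _ _)
    rw [Finset.card_product, Finset.card_product] at h2
    have h3 := Finset.card_union_le (Up L) (Dn L)
    have h4 : (((B ×ˢ B).filter (fun p => 5 * (L : ℝ) ≤ |X p.1 - X p.2|)).card : ℝ) ≤
      2 * B.card * ((Up L).card + (Dn L).card) := by
      have : ((B ×ˢ B).filter (fun p => 5 * (L : ℝ) ≤ |X p.1 - X p.2|)).card ≤
        2 * B.card * ((Up L).card + (Dn L).card) := by nlinarith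
      exact_mod_cast this
    have h5 := hcount.trans h4
    have h6 : (B.card : ℝ) ^ 2 / (2 * R) = 2 * B.card * (B.card / (4 * R)) := by
      field_simp; ring
    rw [h6] at h5
    exact le_of_mul_le_mul_left h5 (by positivity)
  have h8 : (B.card : ℝ) / (8 * R) = (B.card / (4 * R)) / 2 := by field_simp; ring
  have hor : (B.card : ℝ) / (8 * R) ≤ (Up L).card ∨ (B.card : ℝ) / (8 * R) ≤ (Dn L).card := by
    by_contra! h; linarith
  rcases hor with h | h
  · obtain ⟨j, n1, n2, hj⟩ := splitU B Up L hL R β hR hβ hlog hB (fun j => Finset.filter_subset _ _)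
      (by
        intro i j hij x hx
        simp only [Up, Finset.mem_filter] at hx ⊢
        have : (i : ℝ) ≤ j := by exact_mod_cast hij
        exact ⟨hx.1, by linarith⟩)
      (by simp only [Up, Nat.cast_zero, add_zero]; exact_mod_cast hup0) h
    have s1 : B \ Up j ⊆ B.filter (fun x => X x ≤ ((k + 1 + j : ℤ) : ℝ)) := by
      intro x hx
      simp only [Up, Finset.mem_sdiff, Finset.mem_filter, not_and, not_le] at hx ⊢
      have := hx.2 hx.1
      push_cast
      exact ⟨hx.1, by linarith⟩
    have s2 : Up (j + 1) ⊆ B.filter (fun x => ((k + 1 + j : ℤ) : ℝ) + 1 ≤ X x) := by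
      intro x hx
      simp only [Up, Finset.mem_filter] at hx ⊢
      have := hx.2
      push_cast at this ⊢
      exact ⟨hx.1, by linarith⟩
    refine ⟨k + 1 + j, n1.mono s1, n2.mono s2, hj.trans ?_⟩
    have c1 := Finset.card_le_card s1
    have c2 := Finset.card_le_card s2
    gcongr
  · obtain ⟨j, n1, n2, hj⟩ := splitU B Dn L hL R β hR hβ hlog hB (fun j => Finset.filter_subset _ _)
      (by
        intro i j hij x hx
        simp only [Dn, Finset.mem_filter] at hx ⊢
        have : (i : ℝ) ≤ j := by exact_mod_cast hij
        exact ⟨hx.1, by linarith⟩)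
      (by
        have : (Dn 0).card ≤ (B.filter (fun x => X x < k)).card := by
          apply Finset.card_le_card
          intro x hx
          simp only [Dn, Finset.mem_filter, Nat.cast_zero] at hx ⊢
          exact ⟨hx.1, by linarith⟩
        have : 2 * (Dn 0).card ≤ B.card := by omega
        exact_mod_cast this) h
    have s1 : B \ Dn j ⊆ B.filter (fun x => ((k - 2 - j : ℤ) : ℝ) + 1 ≤ X x) := by
      intro x hx
      simp only [Dn, Finset.mem_sdiff, Finset.mem_filter, not_and, not_le] at hx ⊢
      have := hx.2 hx.1
      push_cast
      exact ⟨hx.1, by linarith⟩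
    have s2 : Dn (j + 1) ⊆ B.filter (fun x => X x ≤ ((k - 2 - j : ℤ) : ℝ)) := by
      intro x hx
      simp only [Dn, Finset.mem_filter] at hx ⊢
      have := hx.2
      push_cast at this ⊢
      exact ⟨hx.1, by linarith⟩
    refine ⟨k - 2 - j, n2.mono s2, n1.mono s1, hj.trans ?_⟩
    have c1 := Finset.card_le_card s1
    have c2 := Finset.card_le_card s2
    rw [add_comm]
    gcongr

/-- `g` encodes a pair `(σ,h)` that is shattered by `A`. -/
def ShG {n : ℕ} (s : ℝ) (A : Finset (Fin n → ℝ)) (g : Fin n → Option ℤ) : Prop :=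
  ∀ τ : Finset (Fin n), ∃ f ∈ A, ∀ i k, g i = some k →
    (i ∈ τ → ((k : ℝ) + 1) * s ≤ f i) ∧ (i ∉ τ → f i ≤ k * s)

lemma ShG.mono {n : ℕ} {s : ℝ} {A B : Finset (Fin n → ℝ)} {g : Fin n → Option ℤ}
    (h : ShG s A g) (hAB : A ⊆ B) : ShG s B g := by
  intro τ
  obtain ⟨f, hf, h⟩ := h τ
  exact ⟨f, hAB hf, h⟩

lemma shG_combine {n : ℕ} (s : ℝ) (hs : 0 < s) (B B1 B2 : Finset (Fin n → ℝ))
    (i : Fin n) (a : ℤ)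
    (h1 : B1 ⊆ B) (h2 : B2 ⊆ B) (h1' : ∀ f ∈ B1, f i ≤ a * s)
    (h2' : ∀ f ∈ B2, ((a : ℝ) + 1) * s ≤ f i)
    (S1 S2 : Finset (Fin n → Option ℤ)) (hS1 : ∀ g ∈ S1, ShG s B1 g)
    (hS2 : ∀ g ∈ S2, ShG s B2 g) :
    ∃ S : Finset (Fin n → Option ℤ), (∀ g ∈ S, ShG s B g) ∧ S.card = S1.card + S2.card := by
  classical
  have hnone : ∀ g ∈ S1 ∩ S2, g i = none := by
    intro g hg
    rw [Finset.mem_inter] at hg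
    rcases hgi : g i with _ | k
    · rfl
    · exfalso
      obtain ⟨f, hf, hf'⟩ := hS1 g hg.1 {i}
      obtain ⟨f2, hf2, hf2'⟩ := hS2 g hg.2 ∅
      have e1 := ((hf' i k hgi).1 (by simp)).trans (h1' f hf)
      have e2 := (h2' f2 hf2).trans ((hf2' i k hgi).2 (by simp))
      have e3 := le_of_mul_le_mul_right e1 hs
      have e4 := le_of_mul_le_mul_right e2 hs
      linarith
  let up : (Fin n → Option ℤ) → (Fin n → Option ℤ) := fun g => Function.update g i (some a)
  have hinj : Set.InjOn up (↑(S1 ∩ S2) : Set (Fin n → Option ℤ)) := by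
    intro g hg g' hg' h
    have e := hnone g hg
    have e' := hnone g' hg'
    funext j
    by_cases hj : j = i
    · subst hj; rw [e, e']
    · have := congrFun h j
      simpa [up, hj] using this
  have hdisj : Disjoint (S1 ∪ S2) ((S1 ∩ S2).image up) := by
    rw [Finset.disjoint_left]
    intro g hg hg'
    rw [Finset.mem_image] at hg'
    obtain ⟨g0, hg0, rfl⟩ := hg'
    have hi : up g0 i = some a := by simp [up]
    rw [Finset.mem_union] at hg
    rcases hg with hg | hg
    · obtain ⟨f, hf, hf'⟩ := hS1 _ hg {i}
      have := ((hf' i a hi).1 (by simp)).trans (h1' f hf)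
      nlinarith
    · obtain ⟨f, hf, hf'⟩ := hS2 _ hg ∅
      have := (h2' f hf).trans ((hf' i a hi).2 (by simp))
      nlinarith
  refine ⟨(S1 ∪ S2) ∪ (S1 ∩ S2).image up, ?_, ?_⟩
  · intro g hg
    rw [Finset.mem_union, Finset.mem_union] at hg
    rcases hg with (hg | hg) | hg
    · exact (hS1 g hg).mono h1
    · exact (hS2 g hg).mono h2
    · rw [Finset.mem_image] at hg
      obtain ⟨g0, hg0, rfl⟩ := hg
      rw [Finset.mem_inter] at hg0
      intro τ
      by_cases hi : i ∈ τ
      · obtain ⟨f, hf, hf'⟩ := hS2 g0 hg0.2 τ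
        refine ⟨f, h2 hf, fun j k hjk => ?_⟩
        by_cases hj : j = i
        · subst hj
          have : a = k := by simpa [up] using hjk
          subst this
          exact ⟨fun _ => h2' f hf, fun h => absurd hi h⟩
        · exact hf' j k (by simpa [up, hj] using hjk)
      · obtain ⟨f, hf, hf'⟩ := hS1 g0 hg0.1 τ
        refine ⟨f, h1 hf, fun j k hjk => ?_⟩
        by_cases hj : j = i
        · subst hj
          have : a = k := by simpa [up] using hjk
          subst this
          exact ⟨fun h => absurd h hi, fun _ => h1' f hf⟩
        · exact hf' j k (by simpa [up, hj] using hjk)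
  · rw [Finset.card_union_of_disjoint hdisj, Finset.card_image_of_injOn hinj,
      Finset.card_union_add_card_inter]

lemma exists_coord {n : ℕ} (d : ℕ) (hd : 1 ≤ d) (hdn : d ≤ n) (r : ℝ)
    (B : Finset (Fin n → ℝ)) (hB : 2 ≤ B.card)
    (hsep : ∀ x ∈ B, ∀ y ∈ B, x ≠ y →
      d ≤ (Finset.univ.filter (fun i => r ≤ |x i - y i|)).card) :
    ∃ i, (B.card : ℝ) ^ 2 / (2 * ((n : ℝ) / d)) ≤
      (((B ×ˢ B).filter (fun p => r ≤ |p.1 i - p.2 i|)).card : ℝ) := by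
  classical
  by_contra! H
  have hnpos : 0 < n := by omega
  have hdr : (0 : ℝ) < d := by exact_mod_cast hd
  have hnr : (0 : ℝ) < n := by exact_mod_cast hnpos
  have h1 : ∑ i, (((B ×ˢ B).filter (fun p => r ≤ |p.1 i - p.2 i|)).card : ℝ) <
      ∑ i : Fin n, (B.card : ℝ) ^ 2 / (2 * ((n : ℝ) / d)) := by
    apply Finset.sum_lt_sum_of_nonempty
    · exact ⟨⟨0, hnpos⟩, Finset.mem_univ _⟩
    · intro i _; exact H i
  have h2 : ∑ i : Fin n, (B.card : ℝ) ^ 2 / (2 * ((n : ℝ) / d)) = d * (B.card : ℝ) ^ 2 / 2 := by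
    simp; field_simp
  have h3 : ∑ i, ((B ×ˢ B).filter (fun p => r ≤ |p.1 i - p.2 i|)).card =
      ∑ p ∈ B ×ˢ B, (Finset.univ.filter (fun i => r ≤ |p.1 i - p.2 i|)).card := by
    simp_rw [Finset.card_filter]
    rw [Finset.sum_comm]
  have h4 : B.offDiag.card * d ≤
      ∑ p ∈ B ×ˢ B, (Finset.univ.filter (fun i => r ≤ |p.1 i - p.2 i|)).card := by
    calc B.offDiag.card * d ≤
        ∑ p ∈ B.offDiag, (Finset.univ.filter (fun i => r ≤ |p.1 i - p.2 i|)).card := by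
          rw [← smul_eq_mul]
          apply Finset.card_nsmul_le_sum
          rintro ⟨x, y⟩ hxy
          rw [Finset.mem_offDiag] at hxy
          exact hsep x hxy.1 y hxy.2.1 hxy.2.2
      _ ≤ _ := by
          apply Finset.sum_le_sum_of_subset
          rintro ⟨x, y⟩ hxy
          rw [Finset.mem_offDiag] at hxy
          exact Finset.mem_product.mpr ⟨hxy.1, hxy.2.1⟩
  rw [← h3, Finset.offDiag_card] at h4
  have h5 : ((B.card * B.card - B.card : ℕ) : ℝ) * d ≤
      ∑ i, (((B ×ˢ B).filter (fun p => r ≤ |p.1 i - p.2 i|)).card : ℝ) := by exact_mod_cast h4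
  rw [Nat.cast_sub (Nat.le_mul_self _)] at h5
  push_cast at h5
  rw [h2] at h1
  have hBr : (2 : ℝ) ≤ B.card := by exact_mod_cast hB
  have : (d : ℝ) * (B.card : ℝ) ^ 2 / 2 ≤ ((B.card : ℝ) * B.card - B.card) * d := by
    nlinarith [mul_nonneg hdr.le (mul_nonneg (by linarith : (0 : ℝ) ≤ B.card) (by linarith : (0 : ℝ) ≤ B.card - 2))]
  linarith

lemma many_shattered {n : ℕ} (d : ℕ) (hd : 1 ≤ d) (hdn : d ≤ n) (s : ℝ) (hs : 0 < s)
    (L : ℕ) (hL : 1 ≤ L) (β : ℝ) (hβ : 1 ≤ β)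
    (hlog : Real.log (8 * ((n : ℝ) / d)) ≤ β ^ L * Real.log 2) (b : ℕ) :
    ∀ (B : Finset (Fin n → ℝ)), B.card = b → B.Nonempty →
    (∀ x ∈ B, ∀ y ∈ B, x ≠ y →
      d ≤ (Finset.univ.filter (fun i => 5 * (L : ℝ) * s ≤ |x i - y i|)).card) →
    ∃ S : Finset (Fin n → Option ℤ), (∀ g ∈ S, ShG s B g) ∧
      (B.card : ℝ) ^ (1 / β) ≤ S.card := by
  classical
  induction b using Nat.strong_induction_on with
  | _ b ih =>
  intro B hBb hB hsep
  by_cases h2 : 2 ≤ B.card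
  · obtain ⟨i, hi⟩ := exists_coord d hd hdn _ B h2 hsep
    have hdr : (0 : ℝ) < d := by exact_mod_cast hd
    have hR : 1 ≤ (n : ℝ) / d := by
      rw [le_div_iff₀ hdr]; simpa using hdn
    obtain ⟨a, n1, n2, ha⟩ := oneDim B (fun x => x i / s) L hL ((n : ℝ) / d) β hR hβ hlog hB (by
      have e : ∀ p : (Fin n → ℝ) × (Fin n → ℝ),
          (5 * (L : ℝ) ≤ |p.1 i / s - p.2 i / s|) = (5 * (L : ℝ) * s ≤ |p.1 i - p.2 i|) := by
        intro p
        rw [← sub_div, abs_div, abs_of_pos hs, le_div_iff₀ hs]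
      simp only [e]
      exact hi)
    set B1 := B.filter (fun x => x i / s ≤ a) with hB1
    set B2 := B.filter (fun x => (a : ℝ) + 1 ≤ x i / s) with hB2
    have s1 : B1 ⊆ B := Finset.filter_subset _ _
    have s2 : B2 ⊆ B := Finset.filter_subset _ _
    have d12 : Disjoint B1 B2 := by
      rw [Finset.disjoint_left]
      intro x hx hx'
      simp only [hB1, hB2, Finset.mem_filter] at hx hx'
      linarith [hx.2, hx'.2]
    have hc : B1.card + B2.card ≤ B.card := by
      rw [← Finset.card_union_of_disjoint d12]
      exact Finset.card_le_card (Finset.union_subset s1 s2)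
    have p1 := n1.card_pos
    have p2 := n2.card_pos
    obtain ⟨S1, hS1, c1⟩ := ih B1.card (by omega) B1 rfl n1
      (fun x hx y hy => hsep x (s1 hx) y (s1 hy))
    obtain ⟨S2, hS2, c2⟩ := ih B2.card (by omega) B2 rfl n2
      (fun x hx y hy => hsep x (s2 hx) y (s2 hy))
    obtain ⟨S, hS, c⟩ := shG_combine s hs B B1 B2 i a s1 s2
      (by
        intro f hf
        have := (Finset.mem_filter.mp hf).2
        rwa [div_le_iff₀ hs] at this)
      (by
        intro f hf
        have := (Finset.mem_filter.mp hf).2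
        rwa [le_div_iff₀ hs] at this) S1 S2 hS1 hS2
    refine ⟨S, hS, ?_⟩
    rw [c]; push_cast
    linarith
  · have h1 : B.card = 1 := by have := hB.card_pos; omega
    obtain ⟨f, hf⟩ := hB
    refine ⟨{fun _ => none}, ?_, ?_⟩
    · intro g hg
      rw [Finset.mem_singleton] at hg
      subst hg
      intro τ
      exact ⟨f, hf, by simp⟩
    · rw [h1]; simp

lemma shG_props {n : ℕ} (s : ℝ) (hs : 0 < s) (F : Set (Fin n → ℝ)) (B : Finset (Fin n → ℝ))
    (hBF : ∀ f ∈ B, f ∈ F) (hF : ∀ f ∈ F, ∑ i, |f i| ≤ n) (g : Fin n → Option ℤ)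
    (hg : ShG s B g) :
    Shatters F s (osupp g) ∧ (∑ i, (oabs (g i) : ℝ)) ≤ n / s := by
  classical
  constructor
  · refine ⟨fun i => ((g i).getD 0 : ℤ) * s, fun τ hτ => ?_⟩
    obtain ⟨f, hf, hf'⟩ := hg τ
    refine ⟨f, hBF f hf, ?_, ?_⟩
    · intro x hx hxτ
      simp only [osupp, Finset.mem_filter] at hx
      obtain ⟨k, hk⟩ := Option.ne_none_iff_exists'.mp hx.2
      simpa [hk] using (hf' x k hk).2 hxτ
    · intro x hxτ
      have hx := hτ hxτ
      simp only [osupp, Finset.mem_filter] at hx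
      obtain ⟨k, hk⟩ := Option.ne_none_iff_exists'.mp hx.2
      have := (hf' x k hk).1 hxτ
      simp only [hk, Option.getD_some]
      linarith
  · obtain ⟨f, hf, hf'⟩ := hg (Finset.univ.filter (fun i => 0 ≤ (g i).getD 0))
    rw [le_div_iff₀ hs, Finset.sum_mul]
    refine le_trans (Finset.sum_le_sum fun i _ => ?_) (hF f (hBF f hf))
    rcases hgi : g i with _ | k
    · simp [oabs]
    · have h := hf' i k hgi
      simp only [Finset.mem_filter, Finset.mem_univ, true_and, hgi, Option.getD_some, not_le] at h
      simp only [oabs, Option.getD_some, Nat.cast_natAbs, Int.cast_abs]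
      rcases le_or_gt 0 k with hk | hk
      · have h1 := h.1 hk
        have hk' : (0 : ℝ) ≤ k := by exact_mod_cast hk
        rw [abs_of_nonneg hk']
        have := le_abs_self (f i)
        nlinarith
      · have h1 := h.2 hk
        have hk' : (k : ℝ) < 0 := by exact_mod_cast hk
        rw [abs_of_neg hk']
        have := neg_le_abs (f i)
        nlinarith

lemma fiber_bound {n : ℕ} (d : ℕ) (hd : 1 ≤ d) (hdn : d ≤ n) (t : ℝ) (ht : 0 < t) (ht1 : t ≤ 1)
    (y : Fin n → ℝ) (A : Finset (Fin n → ℝ)) (hA : ∀ f ∈ A, ∑ i, |f i| ≤ n)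
    (hsep : ∀ x ∈ A, ∀ x' ∈ A, x ≠ x' → ∃ i, t ≤ |x i - x' i|)
    (hy : ∀ x ∈ A, (Finset.univ.filter (fun i => t / 2 ≤ |x i - y i|)).card ≤ d) :
    (A.card : ℝ) ≤ Real.exp (d * (5 + Real.log (n / d) + Real.log ((2 * n / t) / d))) := by
  classical
  let G : (Fin n → ℝ) → (Fin n → Option ℤ) := fun x i =>
    if t / 2 ≤ |x i - y i| then some ⌊x i / t⌋ else none
  have hinj : Set.InjOn G (↑A : Set (Fin n → ℝ)) := by
    intro x hx x' hx' h
    by_contra hne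
    obtain ⟨i, hi⟩ := hsep x hx x' hx' hne
    have hG := congrFun h i
    simp only [G] at hG
    by_cases c1 : t / 2 ≤ |x i - y i| <;> by_cases c2 : t / 2 ≤ |x' i - y i|
    · simp only [c1, c2, if_true, Option.some.injEq] at hG
      have := Int.abs_sub_lt_one_of_floor_eq_floor hG
      rw [← sub_div, abs_div, abs_of_pos ht, div_lt_one ht] at this
      linarith
    · simp [c1, c2] at hG
    · simp [c1, c2] at hG
    · push Not at c1 c2
      rw [abs_lt] at c1 c2
      have : |x i - x' i| < t := by rw [abs_lt]; constructor <;> linarith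
      linarith
  rw [← Finset.card_image_of_injOn hinj]
  apply count_bound n d _ hd hdn
  · rw [le_div_iff₀ ht]; 
    have : (0 : ℝ) ≤ n := by positivity
    nlinarith
  · intro g hg
    obtain ⟨x, hx, rfl⟩ := Finset.mem_image.mp hg
    convert hy x hx using 2
    ext i
    simp [osupp, G]
  · intro g hg
    obtain ⟨x, hx, rfl⟩ := Finset.mem_image.mp hg
    calc ∑ i, (oabs (G x i) : ℝ) ≤ ∑ i, (|x i| / t + 1) := by
          apply Finset.sum_le_sum
          intro i _
          simp only [G]
          split_ifs
          · simp only [oabs, Option.getD_some, Nat.cast_natAbs, Int.cast_abs]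
            have e1 := Int.floor_le (x i / t)
            have e2 := Int.lt_floor_add_one (x i / t)
            have e3 : |x i| / t = |x i / t| := by rw [abs_div, abs_of_pos ht]
            rw [e3, abs_le]
            constructor <;> linarith [le_abs_self (x i / t), neg_abs_le (x i / t)]
          · simp only [oabs, Option.getD_none, Int.natAbs_zero, Nat.cast_zero]; positivity
      _ = (∑ i, |x i|) / t + n := by
          rw [Finset.sum_add_distrib, Finset.sum_div]; simp
      _ ≤ n / t + n / t := by
          have := hA x hx
          have h2 : (n : ℝ) ≤ n / t := by
            rw [le_div_iff₀ ht]
            have : (0 : ℝ) ≤ n := by positivity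
            nlinarith
          gcongr
      _ = 2 * n / t := by ring

lemma choose_net {n : ℕ} (d : ℕ) (r : ℝ) (hr : 0 < r) (A : Finset (Fin n → ℝ)) :
    ∃ A' ⊆ A, (∀ x ∈ A', ∀ y ∈ A', x ≠ y →
      d ≤ (Finset.univ.filter (fun i => r ≤ |x i - y i|)).card) ∧
      ∀ x ∈ A, ∃ y ∈ A', (Finset.univ.filter (fun i => r ≤ |x i - y i|)).card ≤ d := by
  classical
  let P : Finset (Finset (Fin n → ℝ)) := A.powerset.filter (fun A' => ∀ x ∈ A', ∀ y ∈ A', x ≠ y →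
      d ≤ (Finset.univ.filter (fun i => r ≤ |x i - y i|)).card)
  have hP : P.Nonempty := ⟨∅, by simp [P]⟩
  obtain ⟨A', hA', hmax⟩ := P.exists_max_image Finset.card hP
  have hA'2 := hA'
  simp only [P, Finset.mem_filter, Finset.mem_powerset] at hA'2
  refine ⟨A', hA'2.1, hA'2.2, ?_⟩
  intro x hx
  by_cases hxA : x ∈ A'
  · refine ⟨x, hxA, ?_⟩
    simp [not_le.mpr hr]
  · by_contra! H
    have : insert x A' ∈ P := by
      simp only [P, Finset.mem_filter, Finset.mem_powerset]
      refine ⟨Finset.insert_subset hx hA'2.1, ?_⟩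
      intro u hu w hw huw
      rw [Finset.mem_insert] at hu hw
      rcases hu with rfl | hu <;> rcases hw with rfl | hw
      · exact absurd rfl huw
      · exact (H w hw).le
      · have := (H u hu).le
        simp_rw [abs_sub_comm (u _)]
        exact this
      · exact hA'2.2 u hu w hw huw
    have := hmax _ this
    rw [Finset.card_insert_of_notMem hxA] at this
    omega

lemma choose_params (R ε : ℝ) (hR : 1 ≤ R) (h0 : 0 < ε) (h1 : ε < 1) :
    ∃ (L : ℕ) (β : ℝ), 1 ≤ L ∧ 1 ≤ β ∧ β ≤ 20 * (Real.log (2 * R)) ^ ε ∧ (L : ℝ) ≤ 2 / ε ∧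
      (L : ℝ) ≤ 2 * R ∧ Real.log (8 * R) ≤ β ^ L * Real.log 2 := by
  have hl2 : (1 : ℝ) / 2 < Real.log 2 := by have := Real.log_two_gt_d9; linarith
  have hl : Real.log 2 ≤ Real.log (2 * R) := Real.log_le_log (by norm_num) (by linarith)
  set l := Real.log (2 * R) with hldef
  have h8 : Real.log (8 * R) ≤ 3 * l := by
    have : (8 : ℝ) * R = 4 * (2 * R) := by ring
    rw [this, Real.log_mul (by norm_num) (by positivity), ← hldef,
      show (4 : ℝ) = 2 ^ 2 by norm_num, Real.log_pow]
    push_cast; linarith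
  have hlpos : 0 < l := by linarith
  have hlow : (1 : ℝ) / 2 ≤ l ^ ε := by
    rcases le_total 1 l with h | h
    · have := Real.one_le_rpow h h0.le; linarith
    · have := Real.self_le_rpow_of_le_one hlpos.le h h1.le; linarith
  have hlR : l ≤ 2 * R - 1 := Real.log_le_sub_one_of_pos (by positivity)
  have hε1 : 1 < 1 / ε := by rw [lt_div_iff₀ h0]; linarith
  by_cases hc : ⌈1 / ε⌉₊ ≤ ⌈l⌉₊
  · refine ⟨⌈1 / ε⌉₊, 20 * l ^ ε, ?_, by linarith, le_rfl, ?_, ?_, ?_⟩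
    · exact Nat.one_le_ceil_iff.mpr (by linarith)
    · have := Nat.ceil_lt_add_one (a := 1 / ε) (by linarith)
      have e : 2 / ε = 1 / ε + 1 / ε := by ring
      linarith
    · have := Nat.ceil_lt_add_one (a := l) (by linarith)
      have e : (⌈1 / ε⌉₊ : ℝ) ≤ ⌈l⌉₊ := by exact_mod_cast hc
      linarith
    · set L := ⌈1 / ε⌉₊ with hL
      have hL1 : 1 ≤ L := Nat.one_le_ceil_iff.mpr (by linarith)
      have hLe : 1 ≤ ε * L := by
        have := Nat.le_ceil (1 / ε)
        rw [div_le_iff₀ h0] at this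
        rw [mul_comm]; exact this
      -- (20 * l^ε)^L ≥ 10 * (2 l^ε)^L
      have e1 : (6 : ℝ) * l ≤ (20 * l ^ ε) ^ L := by
        rcases le_total 1 l with h | h
        · have a1 : l ≤ (l ^ ε) ^ L := by
            rw [← Real.rpow_natCast, ← Real.rpow_mul hlpos.le]
            calc l = l ^ (1 : ℝ) := by simp
              _ ≤ _ := Real.rpow_le_rpow_of_exponent_le h hLe
          have a2 : (20 : ℝ) ≤ 20 ^ L := le_self_pow₀ (by norm_num) (by omega)
          rw [mul_pow]
          have : (20 : ℝ) * l ≤ 20 ^ L * (l ^ ε) ^ L := by gcongr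
          linarith
        · have a1 : (10 : ℝ) ≤ 20 * l ^ ε := by linarith
          have a2 : 20 * l ^ ε ≤ (20 * l ^ ε) ^ L := le_self_pow₀ (by linarith) (by omega)
          linarith
      nlinarith
  · push Not at hc
    set K := ⌈l⌉₊ with hK
    have hK1 : 1 ≤ K := Nat.one_le_ceil_iff.mpr hlpos
    refine ⟨K, 10, hK1, by norm_num, by linarith, ?_, ?_, ?_⟩
    · have := Nat.ceil_lt_add_one (a := 1 / ε) (by linarith)
      have e : 2 / ε = 1 / ε + 1 / ε := by ring
      have e2 : (K : ℝ) < ⌈1 / ε⌉₊ := by exact_mod_cast hc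
      linarith
    · have := Nat.ceil_lt_add_one (a := l) (by linarith)
      linarith
    · have a1 : l ≤ K := Nat.le_ceil _
      have a2 : (9 : ℝ) * K + 1 ≤ 10 ^ K := by
        have := one_add_mul_le_pow (a := (9 : ℝ)) (by norm_num) K
        norm_num at this
        linarith
      nlinarith

lemma main_bound (n d : ℕ) (hd : 1 ≤ d) (hdn : d ≤ n) (F : Set (Fin n → ℝ)) (ε t : ℝ)
    (h0 : 0 < ε) (h1 : ε < 1) (ht : 0 < t) (ht2 : t < 1 / 2)
    (hF : ∀ f ∈ F, ∑ i, |f i| ≤ n)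
    (hsh : ∀ s, 1 / 20 * ε * t ≤ s → ∀ σ, Shatters F s σ → σ.card ≤ d)
    (A : Finset (Fin n → ℝ)) (hA : A.Nonempty) (hAF : ∀ f ∈ A, f ∈ F)
    (hsep : ∀ x ∈ A, ∀ x' ∈ A, x ≠ x' → ∃ i, t ≤ |x i - x' i|) :
    Real.log A.card ≤ 1000 * d * Real.log (n / (d * t)) * (Real.log (2 * n / d)) ^ ε := by
  classical
  have hdr : (1 : ℝ) ≤ d := by exact_mod_cast hd
  have hdnr : (d : ℝ) ≤ n := by exact_mod_cast hdn
  set R : ℝ := n / d with hRdef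
  have hR : 1 ≤ R := by rw [hRdef, le_div_iff₀ (by linarith)]; linarith
  obtain ⟨L, β, hL, hβ, hβ2, hLε, hLR, hlog⟩ := choose_params R ε hR h0 h1
  have hLr : (1 : ℝ) ≤ L := by exact_mod_cast hL
  set s : ℝ := t / (10 * L) with hs
  have hs0 : 0 < s := by positivity
  have hsε : 1 / 20 * ε * t ≤ s := by
    rw [hs, le_div_iff₀ (by positivity)]
    rw [le_div_iff₀ h0] at hLε
    nlinarith
  have h5 : 5 * (L : ℝ) * s = t / 2 := by rw [hs]; field_simp; norm_num
  obtain ⟨A', hA'A, hA'sep, hnet⟩ := choose_net d (t / 2) (by linarith) A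
  have hA'ne : A'.Nonempty := by
    obtain ⟨x, hx⟩ := hA
    obtain ⟨y, hy, _⟩ := hnet x hx
    exact ⟨y, hy⟩
  obtain ⟨S, hS, hScard⟩ := many_shattered d hd hdn s hs0 L hL β hβ hlog A'.card A' rfl hA'ne
    (by rw [h5]; exact hA'sep)
  have hcS := count_bound n d (n / s) hd hdn (by
      rw [le_div_iff₀ hs0]
      have : s ≤ 1 := by rw [hs, div_le_one (by positivity)]; linarith
      nlinarith) S
    (fun g hg => hsh s hsε _ (shG_props s hs0 F A' (fun f hf => hAF f (hA'A hf)) hF g (hS g hg)).1)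
    (fun g hg => (shG_props s hs0 F A' (fun f hf => hAF f (hA'A hf)) hF g (hS g hg)).2)
  choose! φ hφ1 hφ2 using hnet
  have hfib : ∀ y ∈ A', ((A.filter (fun x => φ x = y)).card : ℝ) ≤
      Real.exp (d * (5 + Real.log (n / d) + Real.log ((2 * n / t) / d))) := by
    intro y hy
    apply fiber_bound d hd hdn t ht (by linarith) y
    · intro f hf; exact hF f (hAF f (Finset.mem_filter.mp hf).1)
    · intro x hx x' hx'
      exact hsep x (Finset.mem_filter.mp hx).1 x' (Finset.mem_filter.mp hx').1
    · intro x hx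
      rw [Finset.mem_filter] at hx
      rw [← hx.2]
      exact hφ2 x hx.1
  have hAcard : (A.card : ℝ) ≤ A'.card *
      Real.exp (d * (5 + Real.log (n / d) + Real.log ((2 * n / t) / d))) := by
    rw [Finset.card_eq_sum_card_fiberwise (f := φ) (t := A') hφ1]
    push_cast
    calc _ ≤ ∑ y ∈ A', Real.exp (d * (5 + Real.log (n / d) + Real.log ((2 * n / t) / d))) :=
          Finset.sum_le_sum hfib
      _ = _ := by simp
  have hA'pos : (0 : ℝ) < A'.card := by exact_mod_cast hA'ne.card_pos
  have hApos : (0 : ℝ) < A.card := by exact_mod_cast hA.card_pos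
  have g1 := Real.log_le_log hApos hAcard
  rw [Real.log_mul hA'pos.ne' (Real.exp_pos _).ne', Real.log_exp] at g1
  have g2 := Real.log_le_log (by positivity) (hScard.trans hcS)
  rw [Real.log_exp, Real.log_rpow hA'pos, one_div, ← div_eq_inv_mul,
    div_le_iff₀ (by linarith)] at g2
  -- numeric
  have hl2 : (1 : ℝ) / 2 < Real.log 2 := by have := Real.log_two_gt_d9; linarith
  set Q := Real.log (R / t) with hQ
  have eQ : Real.log (n / (d * t)) = Q := by rw [hQ, hRdef, div_div]
  have eR : 2 * (n : ℝ) / d = 2 * R := by rw [hRdef]; ring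
  have hQsplit : Q = Real.log R + Real.log (1 / t) := by
    rw [hQ, ← Real.log_mul (by positivity) (by positivity)]; congr 1; ring
  have hlogR : 0 ≤ Real.log R := Real.log_nonneg hR
  have hlogt : Real.log 2 ≤ Real.log (1 / t) := by
    apply Real.log_le_log (by norm_num)
    rw [le_div_iff₀ ht]; linarith
  have k1 : 5 + Real.log R + Real.log ((2 * n / t) / d) ≤ 20 * Q := by
    have : (2 * (n : ℝ) / t) / d = 2 * (R * (1 / t)) := by rw [hRdef]; field_simp
    rw [this, Real.log_mul (by norm_num) (by positivity), Real.log_mul (by positivity) (by positivity)]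
    linarith
  have k2 : 5 + Real.log R + Real.log ((n / s) / d) ≤ 20 * Q := by
    have e : ((n : ℝ) / s) / d = 10 * (L * (R * (1 / t))) := by rw [hRdef, hs]; field_simp
    have e10 : Real.log 10 ≤ 4 * Real.log 2 := by
      have : Real.log ((2 : ℝ) ^ 4) = 4 * Real.log 2 := by rw [Real.log_pow]; norm_num
      rw [← this]
      exact Real.log_le_log (by norm_num) (by norm_num)
    have eL : Real.log L ≤ Real.log 2 + Real.log R := by
      rw [← Real.log_mul (by norm_num) (by positivity)]
      exact Real.log_le_log (by linarith) hLR
    rw [e, Real.log_mul (by norm_num) (by positivity), Real.log_mul (by positivity) (by positivity),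
      Real.log_mul (by positivity) (by positivity)]
    linarith
  rw [eQ, eR]
  set W := (Real.log (2 * R)) ^ ε with hW
  have hQ0 : 0 ≤ Q := by linarith
  have hW2 : 1 ≤ 20 * W := hβ.trans hβ2
  have hd0 : (0 : ℝ) ≤ d := by linarith
  have m1 : (d : ℝ) * (5 + Real.log R + Real.log ((2 * n / t) / d)) ≤ d * (20 * Q) := by gcongr
  have m2 : (d : ℝ) * (5 + Real.log R + Real.log ((n / s) / d)) * β ≤ d * (20 * Q) * (20 * W) := by
    have : (d : ℝ) * (5 + Real.log R + Real.log ((n / s) / d)) ≤ d * (20 * Q) := by gcongr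
    calc _ ≤ d * (20 * Q) * β := by gcongr
      _ ≤ _ := by gcongr
  have m3 : (d : ℝ) * (20 * Q) ≤ d * (20 * Q) * (20 * W) :=
    le_mul_of_one_le_right (by positivity) hW2
  have m4 : (0 : ℝ) ≤ d * Q * W := by
    have : 0 ≤ W := by linarith
    positivity
  calc Real.log A.card ≤ d * (20 * Q) * (20 * W) + d * (20 * Q) * (20 * W) := by linarith
    _ = 800 * (d * Q * W) := by ring
    _ ≤ 1000 * (d * Q * W) := by linarith
    _ = _ := by ring

lemma combDim_nat {n : ℕ} (F : Set (Fin n → ℝ)) (u : ℝ) :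
    ∃ d : ℕ, d ≤ n ∧ combDim F u = d ∧ ∀ σ, Shatters F u σ → σ.card ≤ d := by
  classical
  let P : Finset (Finset (Fin n)) := Finset.univ.filter (fun σ => Shatters F u σ)
  refine ⟨P.sup Finset.card, ?_, ?_, ?_⟩
  · apply Finset.sup_le
    intro σ _
    simpa using Finset.card_le_univ σ
  · apply le_antisymm
    · apply iSup₂_le
      intro σ hσ
      have : σ.card ≤ P.sup Finset.card := Finset.le_sup (f := Finset.card) (by simp [P, hσ])
      exact_mod_cast this
    · rcases P.eq_empty_or_nonempty with h | h
      · rw [h]; simp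
      · obtain ⟨σ, hσ, e⟩ := Finset.exists_mem_eq_sup P h Finset.card
        rw [e]
        exact le_iSup₂_of_le σ (by simpa [P] using hσ) le_rfl
  · intro σ hσ
    exact Finset.le_sup (f := Finset.card) (by simp [P, hσ])

lemma Shatters.anti {Ω : Type*} {F : Set (Ω → ℝ)} {u s : ℝ} (h : u ≤ s) {σ : Finset Ω}
    (hs : Shatters F s σ) : Shatters F u σ := by
  obtain ⟨l, hl⟩ := hs
  refine ⟨l, fun τ hτ => ?_⟩
  obtain ⟨f, hf, h1, h2⟩ := hl τ hτ
  exact ⟨f, hf, h1, fun x hx => by linarith [h2 x hx]⟩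

lemma shatters_single {n : ℕ} (F : Set (Fin n → ℝ)) (u : ℝ) (f g : Fin n → ℝ) (hf : f ∈ F)
    (hg : g ∈ F) (i : Fin n) (h : f i + u ≤ g i) : Shatters F u {i} := by
  refine ⟨f, fun τ hτ => ?_⟩
  by_cases hi : i ∈ τ
  · refine ⟨g, hg, ?_, ?_⟩
    · intro x hx hx'
      rw [Finset.mem_singleton] at hx; subst hx; exact absurd hi hx'
    · intro x hx
      have := hτ hx
      rw [Finset.mem_singleton] at this; subst this; exact h
  · refine ⟨f, hf, fun _ _ _ => le_rfl, ?_⟩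
    intro x hx
    have := hτ hx
    rw [Finset.mem_singleton] at this; subst this; exact absurd hx hi

/-- Let `F` be a class of functions on an `n`-point set, `1`-bounded in
`L₁` with respect to the uniform probability measure. Then, for `0 < ε < 1` and
`0 < t < 1/2`, `D_∞(F,t) ≤ C·v·log(n/(v t))·(log(2n/v))^ε` where `v = v(F, c·ε·t)`. -/
theorem DInfty_le_of_L1_bounded :
    ∃ C > (0 : ℝ), ∃ c > (0 : ℝ), ∀ (n : ℕ) (F : Set (Fin n → ℝ)) (ε t : ℝ),
      0 < n → 0 < ε → ε < 1 → 0 < t → t < 1 / 2 →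
      (∀ f ∈ F, (∑ i, |f i|) / n ≤ 1) →
      DInfty F t ≤
        ENNReal.ofReal
          (C * (combDim F (c * ε * t)).toReal *
            Real.log ((n : ℝ) / ((combDim F (c * ε * t)).toReal * t)) *
            (Real.log (2 * (n : ℝ) / (combDim F (c * ε * t)).toReal)) ^ ε) := by
  refine ⟨1000, by norm_num, 1 / 20, by norm_num, ?_⟩
  intro n F ε t hn h0 h1 ht ht2 hF
  classical
  obtain ⟨d, hdn, hdeq, hdmax⟩ := combDim_nat F (1 / 20 * ε * t)
  rw [hdeq, ENNReal.toReal_natCast]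
  have hnr : (0 : ℝ) < n := by exact_mod_cast hn
  have hF' : ∀ f ∈ F, ∑ i, |f i| ≤ n := by
    intro f hf
    have := hF f hf
    rw [div_le_one hnr] at this
    exact this
  apply iSup₂_le
  rintro m ⟨f, hfF, hfsep⟩
  apply ENNReal.ofReal_le_ofReal
  have hsep' : ∀ i j : Fin m, i ≠ j → ∃ ω, t ≤ |f i ω - f j ω| := by
    intro i j hij
    rcases lt_or_gt_of_ne hij with h | h
    · exact hfsep i j h
    · obtain ⟨ω, hω⟩ := hfsep j i h
      exact ⟨ω, by rwa [abs_sub_comm]⟩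
  have hsmall : 1 / 20 * ε * t ≤ t := by nlinarith
  rcases Nat.eq_zero_or_pos d with hd | hd
  · subst hd
    have hm : m ≤ 1 := by
      by_contra! hm
      obtain ⟨ω, hω⟩ := hfsep ⟨0, by omega⟩ ⟨1, hm⟩ (by simp)
      have : ({ω} : Finset (Fin n)).card ≤ 0 := by
        apply hdmax
        rcases le_abs.mp hω with h | h
        · exact shatters_single F _ _ _ (hfF ⟨1, hm⟩) (hfF ⟨0, by omega⟩) ω (by linarith)
        · exact shatters_single F _ _ _ (hfF ⟨0, by omega⟩) (hfF ⟨1, hm⟩) ω (by linarith)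
      simp at this
    interval_cases m <;> simp
  · rcases Nat.eq_zero_or_pos m with hm | hm
    · subst hm
      have hdr : (1 : ℝ) ≤ d := by exact_mod_cast hd
      have hdnr : (d : ℝ) ≤ n := by exact_mod_cast hdn
      have a1 : 0 ≤ Real.log ((n : ℝ) / (d * t)) := by
        apply Real.log_nonneg
        rw [le_div_iff₀ (by positivity)]
        nlinarith
      have a2 : 0 ≤ Real.log (2 * (n : ℝ) / d) := by
        apply Real.log_nonneg
        rw [le_div_iff₀ (by positivity)]
        linarith
      simp only [Nat.cast_zero, Real.log_zero]
      positivity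
    · have hinj : Function.Injective f := by
        intro i j hij
        by_contra hne
        obtain ⟨ω, hω⟩ := hsep' i j hne
        rw [hij] at hω
        simp at hω
        linarith
      have hcard : (Finset.univ.image f).card = m := by
        rw [Finset.card_image_of_injective _ hinj]; simp
      have := main_bound n d hd hdn F ε t h0 h1 ht ht2 hF'
        (fun s hs σ hσ => hdmax σ (hσ.anti hs)) (Finset.univ.image f)
        (by rw [← Finset.card_pos, hcard]; exact hm)
        (by
          intro g hg
          obtain ⟨i, _, rfl⟩ := Finset.mem_image.mp hg
          exact hfF i)
        (by
          intro x hx x' hx' hne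
          obtain ⟨i, _, rfl⟩ := Finset.mem_image.mp hx
          obtain ⟨j, _, rfl⟩ := Finset.mem_image.mp hx'
          exact hsep' i j (fun h => hne (by rw [h])))
      rw [hcard] at this
      exact this
end
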